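/- Let ℰ and ℱ be sets of curves which are locally isomorphic to the coverings Ĉ_R for R a pairing relation satisfying (P), and let A be an unbounded curve contained both in a curve of ℰ and in a curve of ℱ. If there exist x ∈ ℤ^3 and a pairing relation S satisfying (P) such that (ℰ, x) is isomorphic to (Ĉ_S, 0), then ℰ and ℱ can only differ by the connexions between their segments which have x as an endpoint; otherwise, necessarily ℰ = ℱ. -/

import Mathlib

namespace Folding

noncomputable section

open Set

/-- Points of `ℝ^n` with the euclidean distance. -/
abbrev Pt (n : ℕ) := EuclideanSpace ℝ (Fin n)

/-- `p` is a point of the lattice `ℤ^n`. -/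
def latt {n : ℕ} (p : Pt n) : Prop := ∀ i, ∃ m : ℤ, p i = (m : ℝ)

/-- `p` belongs to `m·ℤ^n`. -/
def inLat {n : ℕ} (m : ℕ) (p : Pt n) : Prop := ∀ i, ∃ c : ℤ, p i = (m : ℝ) * (c : ℝ)

/-- The canonical basis vector `e_i`. -/
def uvec (n : ℕ) (i : Fin n) : Pt n := EuclideanSpace.single i (1 : ℝ)

/-- `u` belongs to `E = {e_1, -e_1, …, e_n, -e_n}`. -/
def IsDir {n : ℕ} (u : Pt n) : Prop := ∃ i, u = uvec n i ∨ u = -uvec n i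

/-- A (nonoriented) lattice segment `[x, x + e_i]`, as an unordered pair of endpoints. -/
def IsSeg {n : ℕ} (S : Sym2 (Pt n)) : Prop := ∃ x i, latt x ∧ S = s(x, x + uvec n i)

/-- A curve: a sequence of segments, indexed by an interval of `ℤ` (finite, ℕ-like or ℤ-like),
recorded through its sequence of vertices; two consecutive segments have exactly one common
endpoint, and the common endpoints with the preceding and the following segments differ
(`noback`). -/
structure Curve (n : ℕ) where
  dom : Set ℤ
  ordConn : dom.OrdConnected
  nontriv : ∃ i, i ∈ dom ∧ i + 1 ∈ dom
  v : ℤ → Pt n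
  lattice : ∀ i ∈ dom, latt (v i)
  step : ∀ i : ℤ, i ∈ dom → i + 1 ∈ dom →
    ∃ j, v (i + 1) = v i + uvec n j ∨ v (i + 1) = v i - uvec n j
  noback : ∀ i : ℤ, i - 1 ∈ dom → i + 1 ∈ dom → v (i + 1) ≠ v (i - 1)

namespace Curve

variable {n : ℕ} (c : Curve n)

/-- The segments of a curve. -/
def segs : Set (Sym2 (Pt n)) :=
  {S | ∃ i : ℤ, i ∈ c.dom ∧ i + 1 ∈ c.dom ∧ S = s(c.v i, c.v (i + 1))}

/-- The connexions between segments of a curve: pairs of consecutive segments. -/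
def conn (S T : Sym2 (Pt n)) : Prop :=
  ∃ i : ℤ, i - 1 ∈ c.dom ∧ i + 1 ∈ c.dom ∧
    ((S = s(c.v (i - 1), c.v i) ∧ T = s(c.v i, c.v (i + 1))) ∨
     (T = s(c.v (i - 1), c.v i) ∧ S = s(c.v i, c.v (i + 1))))

/-- A curve is self-avoiding if each of its segments appears only once. -/
def SelfAvoiding : Prop :=
  ∀ i j : ℤ, i ∈ c.dom → i + 1 ∈ c.dom → j ∈ c.dom → j + 1 ∈ c.dom →
    s(c.v i, c.v (i + 1)) = s(c.v j, c.v (j + 1)) → i = j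

/-- A curve without endpoints (indexed by `ℤ`). -/
def NoEndpts : Prop := c.dom = Set.univ

/-- `p` is an endpoint of the curve `c`. -/
def IsEndpt (p : Pt n) : Prop :=
  ∃ i ∈ c.dom, p = c.v i ∧ (i - 1 ∉ c.dom ∨ i + 1 ∉ c.dom)

/-- `S` is the end segment of `c` at its endpoint `p`. -/
def endSegAt (p : Pt n) (S : Sym2 (Pt n)) : Prop :=
  ∃ i : ℤ, i ∈ c.dom ∧ p = c.v i ∧
    ((i - 1 ∉ c.dom ∧ i + 1 ∈ c.dom ∧ S = s(c.v i, c.v (i + 1))) ∨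
     (i + 1 ∉ c.dom ∧ i - 1 ∈ c.dom ∧ S = s(c.v (i - 1), c.v i)))

/-- The number of segments (length) of a curve. -/
def nsegs : ℕ := {i : ℤ | i ∈ c.dom ∧ i + 1 ∈ c.dom}.ncard

end Curve

/-- The trace of a set of curves: its set of segments together with the connexion
relation between segments.  Two sets of curves are geometrically the same set of
(nonoriented) curves iff they have the same trace. -/
structure Trace (n : ℕ) where
  segs : Set (Sym2 (Pt n))
  conn : Sym2 (Pt n) → Sym2 (Pt n) → Prop

def curveTrace {n : ℕ} (c : Curve n) : Trace n := ⟨c.segs, c.conn⟩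

def traceOf {n : ℕ} (E : Set (Curve n)) : Trace n :=
  ⟨{S | ∃ c ∈ E, S ∈ c.segs}, fun S T => ∃ c ∈ E, c.conn S T⟩

/-- Two curves are the same nonoriented curve. -/
def SameCurve {n : ℕ} (c d : Curve n) : Prop := c.segs = d.segs ∧ c.conn = d.conn

/-- A set of pairwise disjoint self-avoiding curves. -/
def DisjSA {n : ℕ} (E : Set (Curve n)) : Prop :=
  (∀ c ∈ E, c.SelfAvoiding) ∧
  ∀ c ∈ E, ∀ d ∈ E, ¬ SameCurve c d → ∀ S, S ∈ c.segs → S ∉ d.segs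

/-- The set of points of `ℝ^n` lying on the segment `S`. -/
def segPts {n : ℕ} (S : Sym2 (Pt n)) : Set (Pt n) :=
  {p | ∃ a b, S = s(a, b) ∧ ∃ t : ℝ, 0 ≤ t ∧ t ≤ 1 ∧ p = a + t • (b - a)}

def Trace.pts {n : ℕ} (T : Trace n) : Set (Pt n) := ⋃ S ∈ T.segs, segPts S

/-- A set of curves covers `X ⊆ ℝ^n`: each lattice segment containing a point of `X`
appears in one and only one of the curves. -/
def Covers {n : ℕ} (E : Set (Curve n)) (X : Set (Pt n)) : Prop :=
  ∀ S, IsSeg S → (segPts S ∩ X).Nonempty →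
    (∃ c ∈ E, S ∈ c.segs) ∧ ∀ c ∈ E, ∀ d ∈ E, S ∈ c.segs → S ∈ d.segs → SameCurve c d

/-- A covering of `ℝ^n` by disjoint self-avoiding curves. -/
def IsCovering {n : ℕ} (E : Set (Curve n)) : Prop := DisjSA E ∧ Covers E Set.univ

/-- A single curve covers `X`. -/
def CurveCovers {n : ℕ} (c : Curve n) (X : Set (Pt n)) : Prop :=
  ∀ S, IsSeg S → (segPts S ∩ X).Nonempty → S ∈ c.segs

/-- `b` is a curve contained in the curve `a`. -/
def SubCurve {n : ℕ} (b a : Curve n) : Prop :=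
  b.segs ⊆ a.segs ∧ ∀ S T, b.conn S T → a.conn S T

/-- The relation `≺` at the level of traces. -/
def TPrec {n : ℕ} (T T' : Trace n) : Prop :=
  T.segs ⊆ T'.segs ∧ ∀ S S', T.conn S S' → T'.conn S S'

/-- `E ≺ F` : each segment of a curve of `E` is a segment of a curve of `F` and each
connexion between two segments of a curve of `E` also exists in `F`. -/
def Prec {n : ℕ} (E F : Set (Curve n)) : Prop := TPrec (traceOf E) (traceOf F)

/-- Image of a trace under a map of `ℝ^n`. -/
def Trace.map {n : ℕ} (f : Pt n → Pt n) (T : Trace n) : Trace n :=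
  ⟨Sym2.map f '' T.segs,
   fun S S' => ∃ A B, T.conn A B ∧ S = Sym2.map f A ∧ S' = Sym2.map f B⟩

/-- Translation of a trace by the vector `t`. -/
def Trace.transl {n : ℕ} (t : Pt n) (T : Trace n) : Trace n := T.map (fun p => p + t)

/-- Property (H) for the pair `(k, l)`. -/
def SatH {n : ℕ} (A : Set (Curve n)) (k l : ℕ) : Prop :=
  0 < k ∧ 0 < l ∧ k ∣ l ∧ IsCovering A ∧
  (∀ c ∈ A, c.dom.Finite ∧ ∃ x i, latt x ∧ inLat k x ∧ c.IsEndpt x ∧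
      c.IsEndpt (x + (k : ℝ) • uvec n i) ∧
      ∀ p, c.IsEndpt p → p = x ∨ p = x + (k : ℝ) • uvec n i) ∧
  (∀ (x : Pt n) (i : Fin n), latt x → inLat k x →
      (∃ c ∈ A, c.IsEndpt x ∧ c.IsEndpt (x + (k : ℝ) • uvec n i)) ∧
      ∀ c ∈ A, ∀ d ∈ A, c.IsEndpt x → c.IsEndpt (x + (k : ℝ) • uvec n i) →
        d.IsEndpt x → d.IsEndpt (x + (k : ℝ) • uvec n i) → SameCurve c d) ∧
  (∀ t : Pt n, inLat l t → Trace.transl t (traceOf A) = traceOf A)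

/-- The trace of the convolution product `A ∗ B`, where `A` satisfies (H) for `(k, l)`:
apply to `B` the homothety of center `0` and ratio `k`, then replace each resulting
segment by the curve of `A` having the same endpoints (connexions come from the curves
of `A`, together with the junctions of the end segments of consecutive `A`-curves). -/
def ConvTrace {n : ℕ} (k : ℕ) (A B : Set (Curve n)) : Trace n where
  segs := {S | ∃ a b : Pt n, s(a, b) ∈ (traceOf B).segs ∧
    ∃ c ∈ A, c.IsEndpt ((k : ℝ) • a) ∧ c.IsEndpt ((k : ℝ) • b) ∧ S ∈ c.segs}
  conn := fun S S' =>
    (∃ a b : Pt n, s(a, b) ∈ (traceOf B).segs ∧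
      ∃ c ∈ A, c.IsEndpt ((k : ℝ) • a) ∧ c.IsEndpt ((k : ℝ) • b) ∧ c.conn S S') ∨
    (∃ a b d : Pt n, (traceOf B).conn s(a, b) s(b, d) ∧
      ∃ c ∈ A, ∃ c' ∈ A, c.IsEndpt ((k : ℝ) • a) ∧ c.IsEndpt ((k : ℝ) • b) ∧
        c'.IsEndpt ((k : ℝ) • b) ∧ c'.IsEndpt ((k : ℝ) • d) ∧
        ((c.endSegAt ((k : ℝ) • b) S ∧ c'.endSegAt ((k : ℝ) • b) S') ∨
         (c.endSegAt ((k : ℝ) • b) S' ∧ c'.endSegAt ((k : ℝ) • b) S)))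

/-- The two-sided identity of the convolution product: the covering consisting of all
curves with one segment. -/
def unitTrace (n : ℕ) : Trace n := ⟨{S | IsSeg S}, fun _ _ => False⟩

/-- `P s` realizes the power `A^s` for the convolution product. -/
def PowersOf {n : ℕ} (A : Set (Curve n)) (k : ℕ) (P : ℕ → Set (Curve n)) : Prop :=
  (∀ s, DisjSA (P s)) ∧ traceOf (P 0) = unitTrace n ∧
  ∀ s, traceOf (P (s + 1)) = ConvTrace k A (P s)

/-- The trace of `Â`, the inductive limit of the `A^s` for `≺`. -/
def hatTrace {n : ℕ} (P : ℕ → Set (Curve n)) : Trace n :=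
  ⟨{S | ∃ s, S ∈ (traceOf (P s)).segs}, fun S T => ∃ s, (traceOf (P s)).conn S T⟩

/-- A pairing relation on `E = {e_1, -e_1, …, e_n, -e_n}`. -/
def IsPairing {n : ℕ} (R : Pt n → Pt n → Prop) : Prop :=
  (∀ u v, R u v → R v u) ∧ (∀ u v, R u v → IsDir u ∧ IsDir v) ∧
  (∀ u, ¬ R u u) ∧ ∀ u, IsDir u → ∃! v, R u v

/-- The trace of `Â_R` : `Â` with the segments with endpoint `0` connected according
to `R`. -/
def hatRTrace {n : ℕ} (P : ℕ → Set (Curve n)) (R : Pt n → Pt n → Prop) : Trace n :=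
  ⟨(hatTrace P).segs,
   fun S T => (hatTrace P).conn S T ∨
     ∃ u v, R u v ∧ S = s((0 : Pt n), u) ∧ T = s((0 : Pt n), v)⟩

/-- The cube `P_{x,h}`. -/
def cube {n : ℕ} (x : Pt n) (h : ℕ) : Set (Pt n) :=
  {p | ∀ i, x i - h ≤ p i ∧ p i ≤ x i + h}

/-- Restriction of a trace to a region `X` of `ℝ^n`. -/
def Trace.restr {n : ℕ} (T : Trace n) (X : Set (Pt n)) : Trace n :=
  ⟨{S | S ∈ T.segs ∧ segPts S ⊆ X},
   fun S S' => T.conn S S' ∧ segPts S ⊆ X ∧ segPts S' ⊆ X⟩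

/-- Condition (C). -/
def CondC {n : ℕ} (T : Trace n) : Prop :=
  ∀ (x : Pt n) (h : ℕ), latt x → 1 ≤ h →
    ∃ y : Pt n, latt y ∧ y ∉ cube x h ∧
      Trace.transl (y - x) (T.restr (cube x h)) = T.restr (cube y h)

/-- `(B(x,r) ∩ T, x) ≅ (B(y,r) ∩ T', y)` : the translation sending `x` to `y` maps
the part of `T` in the closed ball `B(x,r)` onto the part of `T'` in `B(y,r)`,
preserving the connexions between segments. -/
def BallIso {n : ℕ} (T : Trace n) (x : Pt n) (T' : Trace n) (y : Pt n) (r : ℝ) : Prop :=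
  (fun p => p + (y - x)) '' (T.pts ∩ Metric.closedBall x r) =
      T'.pts ∩ Metric.closedBall y r ∧
  (∀ S S', T.conn S S' → segPts S ⊆ Metric.closedBall x r →
      segPts S' ⊆ Metric.closedBall x r →
      T'.conn (Sym2.map (fun p => p + (y - x)) S) (Sym2.map (fun p => p + (y - x)) S')) ∧
  (∀ S S', T'.conn S S' → segPts S ⊆ Metric.closedBall y r →
      segPts S' ⊆ Metric.closedBall y r →
      T.conn (Sym2.map (fun p => p + (x - y)) S) (Sym2.map (fun p => p + (x - y)) S'))

/-- The local isomorphism property. -/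
def LocIsoProp {n : ℕ} (T : Trace n) : Prop :=
  ∀ (x : Pt n) (r : ℝ), 0 ≤ r →
    ∃ t : ℝ, 0 ≤ t ∧ ∀ y : Pt n, ∃ z ∈ Metric.closedBall y t, BallIso T x T z r

/-- Two traces are locally isomorphic. -/
def LocallyIso {n : ℕ} (T T' : Trace n) : Prop :=
  (∀ (x : Pt n) (r : ℝ), 0 ≤ r → ∃ y, BallIso T x T' y r) ∧
  (∀ (y : Pt n) (r : ℝ), 0 ≤ r → ∃ x, BallIso T' y T x r)

/-- `Ω_{s,x}` : suppress the connexions between segments whose common endpoint lies in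
`x + k^s ℤ^n`. -/
def OmegaTrace {n : ℕ} (k s : ℕ) (x : Pt n) (T : Trace n) : Trace n :=
  ⟨T.segs, fun S S' => T.conn S S' ∧ ¬ ∃ p, p ∈ S ∧ p ∈ S' ∧ inLat (k ^ s) (p - x)⟩

/-- `Σ_{s,x}(E)` : for each curve `D` of `E` passing through `x`, the curve(s) with
endpoint `x` contained in `D` having maximal length, this length being limited to
`8^s`. -/
def SigmaSet {n : ℕ} (s : ℕ) (x : Pt n) (E : Set (Curve n)) : Set (Curve n) :=
  {b | ∃ D ∈ E, SubCurve b D ∧ b.IsEndpt x ∧ b.nsegs ≤ 8 ^ s ∧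
    ∀ b' : Curve n, SubCurve b' D → b'.IsEndpt x → b'.nsegs ≤ 8 ^ s →
      SubCurve b b' → SameCurve b b'}

/-- A positive (orientation preserving) isometry of `ℝ^n`. -/
def PosIsom {n : ℕ} (f : Pt n → Pt n) : Prop :=
  ∃ (g : Pt n ≃ₗᵢ[ℝ] Pt n) (t : Pt n), (∀ x, f x = g x + t) ∧
    0 < LinearMap.det (g.toLinearEquiv.toLinearMap)

/-- `E` consists of exactly `m` curves. -/
def HasExactly {n : ℕ} (E : Set (Curve n)) (m : ℕ) : Prop :=
  ∃ L : List (Curve n), L.length = m ∧ (∀ c ∈ L, c ∈ E) ∧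
    L.Pairwise (fun c d => ¬ SameCurve c d) ∧ ∀ c ∈ E, ∃ d ∈ L, SameCurve c d

/-- `E` consists of at most `m` curves. -/
def AtMost {n : ℕ} (E : Set (Curve n)) (m : ℕ) : Prop :=
  ∃ L : List (Curve n), L.length ≤ m ∧ ∀ c ∈ E, ∃ d ∈ L, SameCurve c d

/-- The set of points of a curve. -/
def curvePts {n : ℕ} (c : Curve n) : Set (Pt n) := ⋃ S ∈ c.segs, segPts S

-- ℝ³-specific part
def toPt3 (f : Fin 3 → ℝ) : Pt 3 := (WithLp.equiv 2 (Fin 3 → ℝ)).symm f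

def p3 (a b c : ℤ) : Pt 3 := toPt3 ![(a : ℝ), (b : ℝ), (c : ℝ)]

/-- The vertices of the curve `C`. -/
def CList : List (Pt 3) :=
  [p3 0 0 0, p3 0 (-1) 0, p3 0 (-1) (-1), p3 0 0 (-1), p3 1 0 (-1),
   p3 1 (-1) (-1), p3 1 (-1) 0, p3 1 0 0, p3 2 0 0]

/-- The block `ℬ₀` : six curves given by their lists of successive vertices. -/
def B0 : List (List (Pt 3)) :=
  [ CList,
    [p3 0 0 0, p3 0 0 1, p3 0 1 1, p3 0 1 0, p3 (-1) 1 0, p3 (-1) 1 1,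
     p3 (-1) 0 1, p3 (-1) 0 0, p3 (-2) 0 0],
    [p3 0 0 0, p3 0 0 (-1), p3 (-1) 0 (-1), p3 (-1) 0 0, p3 (-1) 1 0,
     p3 (-1) 1 (-1), p3 0 1 (-1), p3 0 1 0, p3 0 2 0],
    [p3 0 0 0, p3 1 0 0, p3 1 0 1, p3 0 0 1, p3 0 (-1) 1, p3 1 (-1) 1,
     p3 1 (-1) 0, p3 0 (-1) 0, p3 0 (-2) 0],
    [p3 0 0 0, p3 (-1) 0 0, p3 (-1) (-1) 0, p3 0 (-1) 0, p3 0 (-1) 1,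
     p3 (-1) (-1) 1, p3 (-1) 0 1, p3 0 0 1, p3 0 0 2],
    [p3 0 0 0, p3 0 1 0, p3 1 1 0, p3 1 0 0, p3 1 0 (-1), p3 1 1 (-1),
     p3 0 1 (-1), p3 0 0 (-1), p3 0 0 (-2)] ]

def sigma3 : Pt 3 → Pt 3 := fun x => toPt3 ![x 0, -(x 1), -(x 2)]
def tau3 : Pt 3 → Pt 3 := fun x => toPt3 ![x 0, x 2, -(x 1)]
def ups3 : Pt 3 → Pt 3 := fun x => toPt3 ![x 0, -(x 2), x 1]

/-- The four blocks `ℬ₀, ℬ₁, ℬ₂, ℬ₃`. -/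
def blockLists : Fin 4 → List (List (Pt 3)) :=
  ![B0,
    B0.map (List.map fun p => p3 2 2 0 + sigma3 p),
    B0.map (List.map fun p => p3 2 0 2 + tau3 p),
    B0.map (List.map fun p => p3 0 2 2 + ups3 p)]

def listSegs (L : List (Pt 3)) : Set (Sym2 (Pt 3)) :=
  {S | ∃ j : ℕ, j + 1 < L.length ∧ S = s(L.getD j 0, L.getD (j + 1) 0)}

def listConn (L : List (Pt 3)) (S T : Sym2 (Pt 3)) : Prop :=
  ∃ j : ℕ, j + 2 < L.length ∧
    ((S = s(L.getD j 0, L.getD (j + 1) 0) ∧ T = s(L.getD (j + 1) 0, L.getD (j + 2) 0)) ∨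
     (T = s(L.getD j 0, L.getD (j + 1) 0) ∧ S = s(L.getD (j + 1) 0, L.getD (j + 2) 0)))

/-- The trace of the curve given by a list of successive vertices. -/
def listTrace (L : List (Pt 3)) : Trace 3 := ⟨listSegs L, listConn L⟩

/-- The trace of the covering `𝒞 = ⋃_{u ∈ ℤ³, 0 ≤ i ≤ 3} (4u + ℬ_i)`. -/
def CTrace : Trace 3 where
  segs := {S | ∃ u : Pt 3, latt u ∧ ∃ (i : Fin 4), ∃ M ∈ blockLists i,
    S ∈ (Trace.transl ((4 : ℝ) • u) (listTrace M)).segs}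
  conn := fun S T => ∃ u : Pt 3, latt u ∧ ∃ (i : Fin 4), ∃ M ∈ blockLists i,
    (Trace.transl ((4 : ℝ) • u) (listTrace M)).conn S T

open Classical in
/-- The permutation `θ` of `E` with `θ(e₁) = -e₂`, `θ(e₂) = -e₃`, `θ(e₃) = -e₁`
and `θ² = Id`. -/
def theta3 : Pt 3 → Pt 3 := fun u =>
  if u = uvec 3 0 then -uvec 3 1
  else if u = -uvec 3 1 then uvec 3 0
  else if u = uvec 3 1 then -uvec 3 2
  else if u = -uvec 3 2 then uvec 3 1
  else if u = uvec 3 2 then -uvec 3 0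
  else if u = -uvec 3 0 then uvec 3 2
  else u

/-- `R^θ`. -/
def Rtheta (R : Pt 3 → Pt 3 → Prop) : Pt 3 → Pt 3 → Prop :=
  fun u v => R (theta3 u) (theta3 v)

def Rx (P : ℕ → Set (Curve 3)) (x : Pt 3) : Pt 3 → Pt 3 → Prop :=
  fun u v => (hatTrace P).conn s(x, x + u) s(x, x + v)

/-- Condition (P). -/
def SatP (P : ℕ → Set (Curve 3)) (R : Pt 3 → Pt 3 → Prop) : Prop :=
  ∃ x : Pt 3, (∀ i, x i = -2 ∨ x i = 0 ∨ x i = 2 ∨ x i = 4) ∧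
    (¬ ∀ i, x i = 0 ∨ x i = 4) ∧ (Rx P x = R ∨ Rx P x = Rtheta R)

/-- The trace of `Ĉ_X`, the inductive limit of the sets `x_s + 𝒞^s`. -/
def hatXTrace (P : ℕ → Set (Curve 3)) (x : ℕ → Pt 3) : Trace 3 :=
  ⟨{S | ∃ s, 1 ≤ s ∧ S ∈ (Trace.transl (x s) (traceOf (P s))).segs},
   fun S T => ∃ s, 1 ≤ s ∧ (Trace.transl (x s) (traceOf (P s))).conn S T⟩

/-- The curve `c` is equivalent to `C` (image of `C` by a positive isometry). -/
def EquivToC (c : Curve 3) : Prop :=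
  ∃ f, PosIsom f ∧ curveTrace c = Trace.map f (listTrace CList)

/-- `x` is an endpoint of type `0` (resp. `1`) of the curve `c`, for `c`
equivalent to `C`. -/
def EndptType (c : Curve 3) (x : Pt 3) (ty : ℕ) : Prop :=
  ∃ f, PosIsom f ∧ curveTrace c = Trace.map f (listTrace CList) ∧
    x = f (if ty = 0 then p3 0 0 0 else p3 2 0 0)

/-- Integer points. -/
abbrev Z3 := ℤ × ℤ × ℤ

/-- Residues modulo `4` of integer points. -/
abbrev R4 := ZMod 4 × ZMod 4 × ZMod 4

/-- Reduction modulo `4`. -/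
def red : Z3 →+* R4 :=
  (Int.castRingHom _).prodMap ((Int.castRingHom _).prodMap (Int.castRingHom _))

/-- The six directions `e₁, e₂, e₃, -e₁, -e₂, -e₃`. -/
def vec : Fin 6 → Z3 :=
  ![(1, 0, 0), (0, 1, 0), (0, 0, 1), (-1, 0, 0), (0, -1, 0), (0, 0, -1)]

/-- The opposite direction. -/
def neg (u : Fin 6) : Fin 6 := u + 3

/-- The direction paired with `u` at an odd point of residue `r`, each row being
written in base `8`. -/
def pairTable : List ℕ :=
  [0, 34028, 0, 34028, 34028, 152090, 14421, 34028, 0, 14421, 0, 14421, 34028, 109313,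
   14421, 14421, 34028, 109313, 152090, 14421, 14421, 8989, 152090, 14421, 109313, 14421,
   14421, 109313, 34028, 109313, 109313, 100948, 0, 152090, 0, 152090, 109313, 109313,
   152090, 14421, 0, 109313, 0, 109313, 109313, 152090, 152090, 34028, 34028, 34028,
   152090, 152090, 152090, 152090, 14421, 47146, 109313, 152090, 14421, 34028, 109313,
   152769, 34028, 34028]

/-- The pairing of directions at the odd points of the covering `𝒞`. -/
def pr (r : R4) (u : Fin 6) : Fin 6 :=
  Fin.ofNat 6 (pairTable.getD (r.1.val * 16 + r.2.1.val * 4 + r.2.2.val) 0 / 8 ^ u.val % 8)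

/-- Evenness of a residue. -/
def ev (r : R4) : Bool := r.1.val % 2 == 0 && r.2.1.val % 2 == 0 && r.2.2.val % 2 == 0

/-- Evenness of the sum of coordinates of a residue. -/
def evSum (r : R4) : Bool := (r.1.val + r.2.1.val + r.2.2.val) % 2 == 0

/-- The first direction of the curve of `𝒞` joining `2y` to `2y + 2u`, where `r` is the
residue of `y`. -/
def phi (r : R4) (u : Fin 6) : Fin 6 :=
  if evSum r then
    if r.1.val % 2 = 0 then
      if r.2.1.val % 2 = 0 then ![4, 5, 3, 2, 0, 1] u else ![5, 2, 1, 4, 3, 0] u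
    else
      if r.2.1.val % 2 = 0 then ![2, 3, 0, 1, 5, 4] u else ![1, 0, 4, 5, 2, 3] u
  else u

/-- Following a segment of `𝒞` by the next one. -/
def st (p : Z3 × Fin 6) : Z3 × Fin 6 :=
  (p.1 + vec p.2, pr (red (p.1 + vec p.2)) (neg p.2))

/-- The reduction of `st` modulo `4`. -/
def st4 (p : R4 × Fin 6) : R4 × Fin 6 :=
  (p.1 + red (vec p.2), pr (p.1 + red (vec p.2)) (neg p.2))

/-- The direction of the `k`-th segment of the curve of `𝒞` joining `2y` to `2y + 2u`. -/
def word (r : R4) (u : Fin 6) (k : ℕ) : Fin 6 := (st4^[k] (2 * r, phi r u)).2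

lemma neg_neg : ∀ u, neg (neg u) = u := by decide

lemma phi_phi : ∀ r u, phi r (phi r u) = u := by decide +kernel

lemma phi_add_two : ∀ r k u, phi (r + 2 * k) u = phi r u := by decide +kernel

lemma pr_pr : ∀ r, ev r = false → ∀ u, pr r (pr r u) = u ∧ pr r u ≠ u := by decide +kernel

lemma ev_word : ∀ r u k, k < 7 → ev (st4^[k + 1] (2 * r, phi r u)).1 = false := by
  have : ∀ r u, ∀ k : Fin 7, ev (st4^[k + 1] (2 * r, phi r u)).1 = false := by decide +kernel
  exact fun r u k hk => this r u ⟨k, hk⟩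

lemma word_sum : ∀ r u, vec (word r u 0) + vec (word r u 1) + vec (word r u 2) +
    vec (word r u 3) + vec (word r u 4) + vec (word r u 5) + vec (word r u 6) +
    vec (word r u 7) = 2 * vec u := by decide +kernel

lemma word_last : ∀ r u, word r u 7 = neg (phi (r + red (vec u)) (neg u)) := by
  decide +kernel

lemma word_even : ∀ r u, evSum r = true →
    word r u 2 = neg (word r u 0) ∧ word r u 4 = word r u 0 ∧
    word r u 6 = neg (word r u 0) ∧ word r u 5 = neg (word r u 1) ∧
    word r u 7 = word r u 3 ∧ word r u 3 ≠ word r u 1 ∧ word r u 3 ≠ neg (word r u 1) ∧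
    word r u 3 = phi r (word r u 0) := by
  decide +kernel

lemma word_odd : ∀ r u, evSum r = false →
    word r u 4 = word r u 0 ∧ word r u 2 ≠ neg (word r u 0) := by
  decide +kernel

lemma phi_ne : ∀ r r' u, evSum r = true → evSum r' = true → phi r u = phi r' u →
    ev (r - r') = true := by decide +kernel

lemma reach_even : ∀ r u, ∃ k : Fin 8, ev (st4^[k] (r, u)).1 = true := by decide +kernel

lemma evSum_add : ∀ r u, evSum (r + red (vec u)) = !evSum r := by decide +kernel

lemma exists_pr_ne : ∀ r, ev r = false → ∃ z, ev z = false ∧ ev (r + z) = false ∧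
    ∃ u, pr z u ≠ pr (r + z) u := by decide +kernel

/-- The connexions of the power `𝒞ⁿ` at an integer point. -/
def Q : ℕ → Z3 → Fin 6 → Fin 6 → Prop
  | 0 => fun _ _ _ => False
  | n + 1 => fun x u v => (ev (red x) = false ∧ pr (red x) u = v) ∨
      ∃ y, x = 2 * y ∧ Q n y (phi (red y) u) (phi (red y) v)

lemma two_mul_inj {x y : Z3} : 2 * x = 2 * y ↔ x = y := by
  obtain ⟨a, b, c⟩ := x
  obtain ⟨a', b', c'⟩ := y
  simp [Prod.ext_iff]

lemma ev_red (x : Z3) : ev (red x) = true ↔ 2 ∣ x := by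
  have h (a : ℤ) : (a : ZMod 4).val % 2 = 0 ↔ 2 ∣ a := by
    have := ZMod.val_intCast (n := 4) a
    push_cast at this
    omega
  obtain ⟨a, b, c⟩ := x
  have h2 : (2 : Z3) ∣ (a, b, c) ↔ 2 ∣ a ∧ 2 ∣ b ∧ 2 ∣ c := by
    constructor
    · rintro ⟨⟨x, y, z⟩, h⟩
      simp only [Prod.ext_iff] at h
      exact ⟨⟨x, h.1⟩, ⟨y, h.2.1⟩, ⟨z, h.2.2⟩⟩
    · rintro ⟨⟨x, rfl⟩, ⟨y, rfl⟩, ⟨z, rfl⟩⟩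
      exact ⟨(x, y, z), rfl⟩
  rw [h2]
  simp [ev, red, h, and_assoc]

lemma ev_red_false (x : Z3) : ev (red x) = false ↔ ¬ 2 ∣ x := by
  rw [← ev_red, Bool.not_eq_true]

lemma phi_red_add_two (x y : Z3) : phi (red (x + 2 * y)) = phi (red x) := by
  ext1 u
  rw [map_add, map_mul, map_ofNat, phi_add_two]

lemma red_add_four (x y : Z3) : red (x + 4 * y) = red x := by
  rw [map_add, map_mul, map_ofNat, show (4 : R4) = 0 by decide, zero_mul, add_zero]

lemma Q_odd {n : ℕ} {x : Z3} (hx : ¬ 2 ∣ x) (u v : Fin 6) :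
    Q (n + 1) x u v ↔ pr (red x) u = v := by
  constructor
  · rintro (h | ⟨y, rfl, -⟩)
    · exact h.2
    · exact absurd (dvd_mul_right _ _) hx
  · exact fun h => Or.inl ⟨(ev_red_false x).2 hx, h⟩

lemma Q_two_mul {n : ℕ} (y : Z3) (u v : Fin 6) :
    Q (n + 1) (2 * y) u v ↔ Q n y (phi (red y) u) (phi (red y) v) := by
  constructor
  · rintro (h | ⟨z, hz, h⟩)
    · exact absurd (dvd_mul_right _ _) ((ev_red_false _).1 h.1)
    · rwa [two_mul_inj.1 hz]
  · exact fun h => Or.inr ⟨y, rfl, h⟩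

lemma two_pow_dvd_two_mul {n : ℕ} (y : Z3) : 2 ^ (n + 1) ∣ 2 * y ↔ 2 ^ n ∣ y := by
  rw [pow_succ']
  constructor
  · rintro ⟨z, hz⟩
    rw [mul_assoc, two_mul_inj] at hz
    exact ⟨z, hz⟩
  · exact mul_dvd_mul_left 2

lemma Q_add (n : ℕ) : ∀ x z : Z3, ∀ u v, Q n (x + 2 ^ (n + 1) * z) u v ↔ Q n x u v := by
  induction n with
  | zero => exact fun _ _ _ _ => Iff.rfl
  | succ n ih =>
    intro x z u v
    by_cases hx : 2 ∣ x
    · obtain ⟨y, rfl⟩ := hx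
      rw [show 2 * y + 2 ^ (n + 1 + 1) * z = 2 * (y + 2 ^ (n + 1) * z) by ring, Q_two_mul,
        Q_two_mul, ih, show y + 2 ^ (n + 1) * z = y + 2 * (2 ^ n * z) by ring, phi_red_add_two]
    · have e : x + 2 ^ (n + 1 + 1) * z = x + 4 * (2 ^ n * z) := by ring
      rw [Q_odd hx, Q_odd, e, red_add_four]
      rw [e, show (4 : Z3) = 2 * 2 by norm_num, mul_assoc]
      rwa [dvd_add_left (dvd_mul_right _ _)]

lemma Q_congr {n : ℕ} {x y : Z3} (h : 2 ^ (n + 1) ∣ y - x) (u v : Fin 6) :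
    Q n x u v ↔ Q n y u v := by
  obtain ⟨z, hz⟩ := h
  rw [← Q_add n x z, ← hz, add_sub_cancel]

lemma Q_succ (n : ℕ) : ∀ x : Z3, ¬ 2 ^ n ∣ x → ∀ u v, Q (n + 1) x u v ↔ Q n x u v := by
  induction n with
  | zero => simp
  | succ n ih =>
    intro x hx u v
    by_cases h2 : 2 ∣ x
    · obtain ⟨y, rfl⟩ := h2
      rw [two_pow_dvd_two_mul] at hx
      rw [Q_two_mul, Q_two_mul, ih y hx]
    · rw [Q_odd h2, Q_odd h2]

lemma Q_of_dvd (n : ℕ) : ∀ x : Z3, 2 ^ n ∣ x → ∀ u v, ¬ Q n x u v := by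
  induction n with
  | zero => exact fun _ _ _ _ => id
  | succ n ih =>
    intro x hx u v
    obtain ⟨y, rfl⟩ := (dvd_pow_self 2 n.succ_ne_zero).trans hx
    rw [Q_two_mul]
    exact ih y ((two_pow_dvd_two_mul y).1 hx) _ _

/-- The connexions of the inductive limit of the powers of `𝒞`. -/
def QLim (x : Z3) (u v : Fin 6) : Prop := ∃ n, Q n x u v

lemma QLim_iff {n : ℕ} {x : Z3} (hx : ¬ 2 ^ n ∣ x) (u v : Fin 6) :
    QLim x u v ↔ Q n x u v := by
  have mono (m k : ℕ) (hm : ¬ 2 ^ m ∣ x) : Q (m + k) x u v ↔ Q m x u v := by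
    induction k with
    | zero => rfl
    | succ k ih =>
      rw [← ih]
      exact Q_succ _ _ (fun h => hm ((pow_dvd_pow 2 (Nat.le_add_right m k)).trans h)) u v
  refine ⟨fun ⟨m, hm⟩ => ?_, fun h => ⟨n, h⟩⟩
  have hxm : ¬ 2 ^ m ∣ x := fun h => Q_of_dvd m x h u v hm
  rw [← mono n m hx, add_comm, mono m n hxm]
  exact hm

lemma not_QLim_zero (u v : Fin 6) : ¬ QLim 0 u v :=
  fun ⟨n, h⟩ => Q_of_dvd n 0 (dvd_zero _) u v h

/-- The sequence of points `w` with directions `s` follows the connexions of `𝒞 - t` at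
the points outside `2ℤ³ - t`. -/
structure Run (t : Z3) (w : ℕ → Z3) (s : ℕ → Fin 6) : Prop where
  step : ∀ i, w (i + 1) = w i + vec (s i)
  odd : ∀ i, ¬ 2 ∣ w (i + 1) + t → s (i + 1) = pr (red (w (i + 1) + t)) (neg (s i))

namespace Run

variable {t t' : Z3} {w : ℕ → Z3} {s : ℕ → Fin 6}

lemma next (h : Run t w s) (n : ℕ) (hodd : ev (st4 (red (w n + t), s n)).1 = false) :
    (red (w (n + 1) + t), s (n + 1)) = st4 (red (w n + t), s n) := by
  have e : red (w (n + 1) + t) = red (w n + t) + red (vec (s n)) := by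
    rw [← map_add, h.step]
    congr 1
    ring
  have := h.odd n
  rw [← ev_red_false, e] at this
  rw [e, this hodd]
  rfl

lemma iterate (h : Run t w s) (n k : ℕ)
    (hodd : ∀ j < k, ev (st4^[j + 1] (red (w n + t), s n)).1 = false) :
    (red (w (n + k) + t), s (n + k)) = st4^[k] (red (w n + t), s n) := by
  induction k with
  | zero => rfl
  | succ k ih =>
    have ih := ih fun j hj => hodd j (hj.trans k.lt_succ_self)
    have hk := hodd k k.lt_succ_self
    rw [Function.iterate_succ_apply', ← ih] at hk ⊢
    exact h.next _ hk

lemma exists_even (h : Run t w s) : ∃ n y, w n + t = 2 * y := by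
  by_contra! hne
  have hodd (n : ℕ) : ev (red (w n + t)) = false := by
    rw [ev_red_false]
    rintro ⟨y, hy⟩
    exact hne n y hy
  have key (k : ℕ) : (red (w k + t), s k) = st4^[k] (red (w 0 + t), s 0) := by
    induction k with
    | zero => rfl
    | succ k ih =>
      rw [Function.iterate_succ_apply', ← ih]
      have e : red (w (k + 1) + t) = red (w k + t) + red (vec (s k)) := by
        rw [← map_add, h.step]
        congr 1
        ring
      exact h.next k ((congrArg ev e).symm.trans (hodd _))
  obtain ⟨k, hk⟩ := reach_even (red (w 0 + t)) (s 0)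
  rw [← key, hodd] at hk
  exact absurd hk (by decide)

lemma block (h : Run t w s) {n : ℕ} {y : Z3} (hy : w n + t = 2 * y) :
    (∀ k < 8, s (n + k) = word (red y) (phi (red y) (s n)) k) ∧
      w (n + 8) + t = 2 * (y + vec (phi (red y) (s n))) := by
  have key : ∀ k < 8, s (n + k) = word (red y) (phi (red y) (s n)) k := by
    intro k hk
    have e : (red (w n + t), s n) =
        (2 * red y, phi (red y) (phi (red y) (s n))) := by
      rw [hy, phi_phi, map_mul, map_ofNat]
    have := h.iterate n k fun j hj => by
      rw [e]
      exact ev_word _ _ _ (by omega)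
    rw [e] at this
    exact congrArg Prod.snd this
  refine ⟨key, ?_⟩
  rw [mul_add, ← word_sum (red y), ← hy, ← key 0, ← key 1, ← key 2, ← key 3, ← key 4, ← key 5,
    ← key 6, ← key 7]
  · rw [h.step (n + 7), h.step (n + 6), h.step (n + 5), h.step (n + 4), h.step (n + 3),
      h.step (n + 2), h.step (n + 1), h.step n, add_zero]
    ring
  all_goals norm_num

lemma blocks (h : Run t w s) {o : ℕ} {y : Z3} (hy : w o + t = 2 * y) (j : ℕ) :
    ∃ z, w (o + 8 * j) + t = 2 * z ∧
      evSum (red z) = if Even j then evSum (red y) else !evSum (red y) := by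
  induction j with
  | zero => exact ⟨y, hy, by simp⟩
  | succ j ih =>
    obtain ⟨z, hz, hp⟩ := ih
    refine ⟨_, (h.block hz).2, ?_⟩
    rw [map_add, evSum_add, hp]
    by_cases hj : Even j <;> simp [hj, Nat.even_add_one]

lemma exists_start (h : Run t w s) : ∃ o y, w o + t = 2 * y ∧ evSum (red y) = true := by
  obtain ⟨n, y, hy⟩ := h.exists_even
  cases hp : evSum (red y)
  · obtain ⟨z, hz, hp'⟩ := h.blocks hy 1
    exact ⟨_, z, hz, by simpa [hp] using hp'⟩
  · exact ⟨n, y, hy, hp⟩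

end Run

/-- The relations between directions that locate the endpoints of even type along a path. -/
structure Located (s : ℕ → Fin 6) (o : ℕ) : Prop where
  opp : ∀ n, o ≤ n → (n - o) % 16 ∈ [0, 2, 4] → s (n + 2) = neg (s n)
  nopp : ∀ n, o ≤ n → (n - o) % 16 ∈ [1, 3, 5, 8] → s (n + 2) ≠ neg (s n)
  four : ∀ n, o ≤ n → (n - o) % 16 ∈ [3, 8] → s (n + 4) = s n
  nfour : ∀ n, o ≤ n → (n - o) % 16 = 1 → s (n + 4) = neg (s n)

lemma neg_ne : ∀ u, neg u ≠ u := by decide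

lemma Located.add_ne {s : ℕ → Fin 6} {o o' d : ℕ} (h : Located s o) (h' : Located s o')
    (hd : d ∈ Finset.Icc 1 8) (ho : o' % 16 = (o + d) % 16) : False := by
  have oppose (a b n : ℕ) (hn : o ≤ n) (hn' : o' ≤ n) (hb : (n - o) % 16 = b)
      (ha : (n - o') % 16 = a) (hb' : b ∈ [1, 3, 5, 8]) (ha' : a ∈ [0, 2, 4]) : False :=
    h.nopp n hn (hb ▸ hb') (h'.opp n hn' (ha ▸ ha'))
  have oppose' (b n : ℕ) (hn : o ≤ n) (hn' : o' ≤ n) (hb : (n - o) % 16 = b)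
      (ha : (n - o') % 16 = 1) (hb' : b ∈ [3, 8]) : False :=
    neg_ne (s n) ((h'.nfour n hn' ha).symm.trans (h.four n hn (hb ▸ hb')))
  rw [Finset.mem_Icc] at hd
  obtain ⟨h1, h8⟩ := hd
  have hM : o + 16 * o' ≥ o' := by omega
  interval_cases d
  · exact oppose 0 1 (o + 16 * o' + 1) (by omega) (by omega) (by omega) (by omega)
      (by decide) (by decide)
  · exact oppose' 3 (o + 16 * o' + 3) (by omega) (by omega) (by omega) (by omega) (by decide)
  · exact oppose 0 3 (o + 16 * o' + 3) (by omega) (by omega) (by omega) (by omega)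
      (by decide) (by decide)
  · exact oppose 4 8 (o + 16 * o' + 8) (by omega) (by omega) (by omega) (by omega)
      (by decide) (by decide)
  · exact oppose 0 5 (o + 16 * o' + 5) (by omega) (by omega) (by omega) (by omega)
      (by decide) (by decide)
  · exact oppose 2 8 (o + 16 * o' + 8) (by omega) (by omega) (by omega) (by omega)
      (by decide) (by decide)
  · exact oppose' 8 (o + 16 * o' + 8) (by omega) (by omega) (by omega) (by omega) (by decide)
  · exact oppose 0 8 (o + 16 * o' + 8) (by omega) (by omega) (by omega) (by omega)
      (by decide) (by decide)

lemma Located.mod_eq {s : ℕ → Fin 6} {o o' : ℕ} (h : Located s o) (h' : Located s o') :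
    o % 16 = o' % 16 := by
  by_contra hne
  by_cases hd : (o' + 16 - o % 16) % 16 ≤ 8
  · exact h.add_ne h' (d := (o' + 16 - o % 16) % 16) (Finset.mem_Icc.2 (by omega)) (by omega)
  · exact h'.add_ne h (d := (o + 16 - o' % 16) % 16) (Finset.mem_Icc.2 (by omega)) (by omega)

namespace Run

variable {t t' : Z3} {w : ℕ → Z3} {s : ℕ → Fin 6}

lemma located (h : Run t w s) {o : ℕ} {y : Z3} (hy : w o + t = 2 * y)
    (hp : evSum (red y) = true) : Located s o := by
  have even (n : ℕ) (hn : o ≤ n) : ∃ i r, i ≤ n ∧ i = o + 8 * (2 * ((n - o) / 16)) ∧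
      evSum r = true ∧ ∀ k < 8, s (i + k) = word r (phi r (s i)) k := by
    obtain ⟨z, hz, hpz⟩ := h.blocks hy (2 * ((n - o) / 16))
    exact ⟨_, red z, by omega, rfl, by simpa [hp] using hpz, (h.block hz).1⟩
  have odd (n : ℕ) (hn : o ≤ n) : ∃ i r, i = o + 8 * (2 * ((n - o) / 16) + 1) ∧
      evSum r = false ∧ ∀ k < 8, s (i + k) = word r (phi r (s i)) k := by
    obtain ⟨z, hz, hpz⟩ := h.blocks hy (2 * ((n - o) / 16) + 1)
    exact ⟨_, red z, rfl, by simpa [hp, Nat.even_add_one] using hpz, (h.block hz).1⟩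
  constructor
  · intro n hn hr
    obtain ⟨i, r, hin, hi, hp, hs⟩ := even n hn
    obtain ⟨e2, e4, e6, -⟩ := word_even r (phi r (s i)) hp
    simp only [List.mem_cons, List.not_mem_nil, or_false] at hr
    rcases hr with hr | hr | hr
    · rw [show n = i + 0 by omega, show i + 0 + 2 = i + 2 by omega, hs 2 (by omega),
        hs 0 (by omega), e2]
    · rw [show n = i + 2 by omega, show i + 2 + 2 = i + 4 by omega, hs 4 (by omega),
        hs 2 (by omega), e2, e4, neg_neg]
    · rw [show n = i + 4 by omega, show i + 4 + 2 = i + 6 by omega, hs 6 (by omega),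
        hs 4 (by omega), e6, e4]
  · intro n hn hr
    simp only [List.mem_cons, List.not_mem_nil, or_false] at hr
    obtain ⟨i, r, hin, hi, hp, hs⟩ := even n hn
    obtain ⟨-, -, -, e5, e7, n31, n31', -⟩ := word_even r (phi r (s i)) hp
    rcases hr with hr | hr | hr | hr
    · rwa [show n = i + 1 by omega, show i + 1 + 2 = i + 3 by omega, hs 3 (by omega),
        hs 1 (by omega)]
    · rw [show n = i + 3 by omega, show i + 3 + 2 = i + 5 by omega, hs 5 (by omega),
        hs 3 (by omega), e5]
      intro e
      exact n31 (by rw [← neg_neg (word _ _ 3), ← e, neg_neg])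
    · rwa [show n = i + 5 by omega, show i + 5 + 2 = i + 7 by omega, hs 7 (by omega),
        hs 5 (by omega), e5, e7, neg_neg]
    · obtain ⟨i, r, hi, hp, hs⟩ := odd n hn
      rw [show n = i + 0 by omega, show i + 0 + 2 = i + 2 by omega, hs 2 (by omega),
        hs 0 (by omega)]
      exact (word_odd r (phi r (s i)) hp).2
  · intro n hn hr
    simp only [List.mem_cons, List.not_mem_nil, or_false] at hr
    rcases hr with hr | hr
    · obtain ⟨i, r, hin, hi, hp, hs⟩ := even n hn
      rw [show n = i + 3 by omega, show i + 3 + 4 = i + 7 by omega, hs 7 (by omega),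
        hs 3 (by omega), (word_even r (phi r (s i)) hp).2.2.2.2.1]
    · obtain ⟨i, r, hi, hp, hs⟩ := odd n hn
      rw [show n = i + 0 by omega, show i + 0 + 4 = i + 4 by omega, hs 4 (by omega),
        hs 0 (by omega), (word_odd r (phi r (s i)) hp).1]
  · intro n hn hr
    obtain ⟨i, r, hin, hi, hp, hs⟩ := even n hn
    rw [show n = i + 1 by omega, show i + 1 + 4 = i + 5 by omega, hs 5 (by omega),
      hs 1 (by omega), (word_even r (phi r (s i)) hp).2.2.2.1]

lemma four_dvd_of_le (h : Run t w s) (h' : Run t' w s) {o o' : ℕ} {y y' : Z3}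
    (hy : w o + t = 2 * y) (hp : evSum (red y) = true) (hy' : w o' + t' = 2 * y')
    (hp' : evSum (red y') = true) (hle : o ≤ o') : 4 ∣ t - t' := by
  have hmod := (h.located hy hp).mod_eq (h'.located hy' hp')
  obtain ⟨z, hz, hpz⟩ := h.blocks hy (2 * ((o' - o) / 16))
  rw [show o + 8 * (2 * ((o' - o) / 16)) = o' by omega] at hz
  replace hpz : evSum (red z) = true := by simpa [hp] using hpz
  have key {t z} (h : Run t w s) (hz : w o' + t = 2 * z) (hpz : evSum (red z) = true) :
      s (o' + 3) = phi (red z) (s o') := by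
    have hb := (h.block hz).1
    rw [hb 3 (by norm_num), (word_even _ _ hpz).2.2.2.2.2.2.2, ← hb 0 (by norm_num), add_zero]
  have := phi_ne _ _ _ hpz hp' ((key h hz hpz).symm.trans (key h' hy' hp'))
  rw [← map_sub, ev_red] at this
  obtain ⟨m, hm⟩ := this
  refine ⟨m, ?_⟩
  linear_combination hz - hy' + 2 * hm

lemma four_dvd (h : Run t w s) (h' : Run t' w s) : 4 ∣ t - t' := by
  obtain ⟨o, y, hy, hp⟩ := h.exists_start
  obtain ⟨o', y', hy', hp'⟩ := h'.exists_start
  rcases le_total o o' with hle | hle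
  · exact h.four_dvd_of_le h' hy hp hy' hp' hle
  · rw [← dvd_neg, neg_sub]
    exact h'.four_dvd_of_le h hy' hp' hy hp hle

end Run

/-- The connexions `K` are those of `𝒞ⁿ - t` outside `2ⁿℤ³ - t`. -/
def Lev (n : ℕ) (K : Z3 → Fin 6 → Fin 6 → Prop) (t : Z3) : Prop :=
  ∀ x, ¬ 2 ^ n ∣ x + t → ∀ u v, K x u v ↔ Q n (x + t) u v

/-- The sequence of points `w` with directions `s` follows the connexions `K`. -/
structure IsPath (K : Z3 → Fin 6 → Fin 6 → Prop) (w : ℕ → Z3) (s : ℕ → Fin 6) : Prop where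
  step : ∀ i, w (i + 1) = w i + vec (s i)
  conn : ∀ i, K (w (i + 1)) (neg (s i)) (s (i + 1))

lemma IsPath.run {n : ℕ} {K : Z3 → Fin 6 → Fin 6 → Prop} {t : Z3} {w : ℕ → Z3}
    {s : ℕ → Fin 6} (h : IsPath K w s) (hK : Lev (n + 1) K t) : Run t w s where
  step := h.step
  odd i hi := by
    have := h.conn i
    rw [hK _ fun hd => hi ((dvd_pow_self 2 n.succ_ne_zero).trans hd), Q_odd hi] at this
    exact this.symm

lemma IsPath.derive {K : Z3 → Fin 6 → Fin 6 → Prop} {t : Z3} {w : ℕ → Z3} {s : ℕ → Fin 6}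
    (h : IsPath K w s) {y : ℕ → Z3} {o : ℕ} (hr : Run t w s)
    (hy : ∀ j, w (o + 8 * j) + t = 2 * y j) :
    IsPath (fun x u v => K (2 * x - t) (phi (red x) u) (phi (red x) v)) y
      (fun j => phi (red (y j)) (s (o + 8 * j))) := by
  have step (j : ℕ) : y (j + 1) = y j + vec (phi (red (y j)) (s (o + 8 * j))) :=
    two_mul_inj.1 ((hy (j + 1)).symm.trans (hr.block (hy j)).2)
  refine ⟨step, fun j => ?_⟩
  have h7 := (hr.block (hy j)).1 7 (by norm_num)
  rw [word_last, ← map_add, ← step] at h7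
  have := h.conn (o + 8 * j + 7)
  rw [h7, neg_neg] at this
  rw [phi_phi, ← hy (j + 1), add_sub_cancel_right]
  exact this

/-- A path contained in two coverings locates both of them. -/
theorem IsPath.dvd (n : ℕ) : ∀ {K K' : Z3 → Fin 6 → Fin 6 → Prop} {t t' : Z3} {w : ℕ → Z3}
    {s : ℕ → Fin 6}, IsPath K w s → IsPath K' w s → Lev (n + 1) K t → Lev (n + 1) K' t' →
    2 ^ (n + 2) ∣ t - t' := by
  induction n with
  | zero =>
    intro K K' t t' w s h h' hK hK'
    convert (h.run hK).four_dvd (h'.run hK') using 1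
    norm_num
  | succ n ih =>
    intro K K' t t' w s h h' hK hK'
    have hr := h.run hK
    obtain ⟨m, hm⟩ := hr.four_dvd (h'.run hK')
    obtain ⟨o, z, hz⟩ := hr.exists_even
    choose y hy _ using hr.blocks hz
    have lev {K : Z3 → Fin 6 → Fin 6 → Prop} {t' m : Z3} (hK : Lev (n + 2) K t')
        (hm : t' = t + 4 * m) :
        Lev (n + 1) (fun x u v => K (2 * x - t) (phi (red x) u) (phi (red x) v)) (2 * m) := by
      intro x hx u v
      have e : 2 * x - t + t' = 2 * (x + 2 * m) := by rw [hm]; ring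
      beta_reduce
      rw [hK, e, Q_two_mul, phi_red_add_two, phi_phi, phi_phi]
      rwa [e, two_pow_dvd_two_mul]
    have := ih (h.derive hr hy) (h'.derive hr hy) (lev (m := 0) hK (by ring))
      (lev (m := -m) hK' (by linear_combination -hm))
    rw [hm, show n + 1 + 2 = n + 2 + 1 from rfl, show (4 : Z3) * m = 2 * (2 * m) by ring,
      two_pow_dvd_two_mul]
    convert this using 1
    ring

/-- The embedding of the integer points. -/
def emb (x : Z3) : Pt 3 := p3 x.1 x.2.1 x.2.2

lemma emb_zero_coord (x : Z3) : emb x 0 = x.1 := rfl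
lemma emb_one_coord (x : Z3) : emb x 1 = x.2.1 := rfl
lemma emb_two_coord (x : Z3) : emb x 2 = x.2.2 := rfl

lemma pt_ext {p q : Pt 3} (h0 : p 0 = q 0) (h1 : p 1 = q 1) (h2 : p 2 = q 2) : p = q := by
  ext i
  fin_cases i <;> assumption

lemma emb_add (x y : Z3) : emb (x + y) = emb x + emb y := by
  apply pt_ext <;> simp [emb_zero_coord, emb_one_coord, emb_two_coord]

lemma emb_neg (x : Z3) : emb (-x) = -emb x := by
  apply pt_ext <;> simp [emb_zero_coord, emb_one_coord, emb_two_coord]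

lemma emb_sub (x y : Z3) : emb (x - y) = emb x - emb y := by
  rw [sub_eq_add_neg, emb_add, emb_neg, ← sub_eq_add_neg]

lemma emb_zero : emb 0 = 0 := by
  apply pt_ext <;> simp [emb_zero_coord, emb_one_coord, emb_two_coord]

lemma emb_two_mul (x : Z3) : emb (2 * x) = (2 : ℝ) • emb x := by
  apply pt_ext <;> simp [emb_zero_coord, emb_one_coord, emb_two_coord]

lemma emb_four_mul (x : Z3) : emb (4 * x) = (4 : ℝ) • emb x := by
  apply pt_ext <;> simp [emb_zero_coord, emb_one_coord, emb_two_coord]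

lemma emb_injective : Function.Injective emb := by
  rintro ⟨a, b, c⟩ ⟨a', b', c'⟩ h
  have h0 := congrArg (fun p : Pt 3 => p 0) h
  have h1 := congrArg (fun p : Pt 3 => p 1) h
  have h2 := congrArg (fun p : Pt 3 => p 2) h
  simp only [emb_zero_coord, emb_one_coord, emb_two_coord, Int.cast_inj] at h0 h1 h2
  rw [h0, h1, h2]

lemma latt_iff {p : Pt 3} : latt p ↔ ∃ x, p = emb x := by
  constructor
  · intro h
    obtain ⟨a, ha⟩ := h 0
    obtain ⟨b, hb⟩ := h 1
    obtain ⟨c, hc⟩ := h 2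
    exact ⟨(a, b, c), pt_ext ha hb hc⟩
  · rintro ⟨x, rfl⟩ i
    fin_cases i
    exacts [⟨_, rfl⟩, ⟨_, rfl⟩, ⟨_, rfl⟩]

lemma inLat_two_iff {p : Pt 3} : inLat 2 p ↔ ∃ x, p = emb (2 * x) := by
  constructor
  · intro h
    obtain ⟨a, ha⟩ := h 0
    obtain ⟨b, hb⟩ := h 1
    obtain ⟨c, hc⟩ := h 2
    refine ⟨(a, b, c), ?_⟩
    rw [emb_two_mul]
    exact pt_ext ha hb hc
  · rintro ⟨x, rfl⟩ i
    rw [emb_two_mul]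
    fin_cases i
    exacts [⟨x.1, by simp [emb_zero_coord]⟩, ⟨x.2.1, by simp [emb_one_coord]⟩,
      ⟨x.2.2, by simp [emb_two_coord]⟩]

lemma uvec_eq : ∀ i : Fin 3, uvec 3 i = emb (vec (Fin.castLE (by norm_num) i)) := by
  intro i
  fin_cases i <;> apply pt_ext <;>
    simp [uvec, vec, emb_zero_coord, emb_one_coord, emb_two_coord]

lemma vec_neg : ∀ u, vec (neg u) = -vec u := by decide

lemma vec_injective : Function.Injective vec := by decide

lemma vec_ne_zero : ∀ u, vec u ≠ 0 := by decide

lemma neg_uvec_eq (i : Fin 3) : -uvec 3 i = emb (vec (neg (Fin.castLE (by norm_num) i))) := by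
  rw [vec_neg, emb_neg, uvec_eq]

lemma dir_cases : ∀ u : Fin 6, ∃ i : Fin 3, u = Fin.castLE (by norm_num) i ∨
    u = neg (Fin.castLE (by norm_num) i) := by decide

lemma isDir_iff {p : Pt 3} : IsDir p ↔ ∃ u, p = emb (vec u) := by
  constructor
  · rintro ⟨i, rfl | rfl⟩
    exacts [⟨_, uvec_eq i⟩, ⟨_, neg_uvec_eq i⟩]
  · rintro ⟨u, rfl⟩
    obtain ⟨i, rfl | rfl⟩ := dir_cases u
    exacts [⟨i, Or.inl (uvec_eq i).symm⟩, ⟨i, Or.inr (neg_uvec_eq i).symm⟩]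

/-- The segment of origin `x` and direction `u`. -/
def seg (x : Z3) (u : Fin 6) : Sym2 (Pt 3) := s(emb x, emb (x + vec u))

lemma seg_neg (x : Z3) (u : Fin 6) : seg (x + vec u) (neg u) = seg x u := by
  rw [seg, seg, vec_neg, add_neg_cancel_right, Sym2.eq_swap]

lemma isSeg_iff {S : Sym2 (Pt 3)} : IsSeg S ↔ ∃ x u, S = seg x u := by
  constructor
  · rintro ⟨p, i, hp, rfl⟩
    obtain ⟨x, rfl⟩ := latt_iff.1 hp
    exact ⟨x, _, by rw [seg, emb_add, uvec_eq]⟩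
  · rintro ⟨x, u, rfl⟩
    obtain ⟨i, rfl | rfl⟩ := dir_cases u
    · exact ⟨_, i, latt_iff.2 ⟨x, rfl⟩, by rw [seg, emb_add, uvec_eq]⟩
    · refine ⟨emb (x + vec (neg (Fin.castLE (by norm_num) i))), i, latt_iff.2 ⟨_, rfl⟩, ?_⟩
      rw [uvec_eq, ← emb_add, vec_neg, neg_add_cancel_right, ← vec_neg, seg, Sym2.eq_swap]

lemma seg_injective (x : Z3) : Function.Injective (seg x) := by
  intro u v h
  simp only [seg, Sym2.eq_iff, emb_injective.eq_iff, true_and, add_right_inj, left_eq_add] at h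
  rcases h with h | h
  · exact vec_injective h
  · exact absurd h.1 (vec_ne_zero v)

lemma seg_pair {x x' : Z3} {u v u' v' : Fin 6} (h : seg x u = seg x' u')
    (h' : seg x v = seg x' v') (huv : u ≠ v) : x = x' ∧ u = u' ∧ v = v' := by
  have hx : x = x' := by
    by_contra hx
    simp only [seg, Sym2.eq_iff, emb_injective.eq_iff, hx, false_and, false_or] at h h'
    exact huv (vec_injective (add_left_cancel (h.2.trans h'.2.symm)))
  subst hx
  exact ⟨rfl, seg_injective x h, seg_injective x h'⟩

lemma map_seg (x y : Z3) (u : Fin 6) :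
    Sym2.map (fun p => p + emb y) (seg x u) = seg (x + y) u := by
  simp only [seg, Sym2.map_mk, ← emb_add]
  rw [add_right_comm]

namespace Curve

variable (c : Curve 3)

/-- The curve `c` traversed backwards. -/
def reverse : Curve 3 where
  dom := {i | -i ∈ c.dom}
  ordConn := by
    refine ⟨fun i hi j hj k hk => ?_⟩
    exact c.ordConn.out hj hi ⟨neg_le_neg hk.2, neg_le_neg hk.1⟩
  nontriv := by
    obtain ⟨i, hi, hi'⟩ := c.nontriv
    exact ⟨-(i + 1), by simpa using hi', by simpa using hi⟩
  v i := c.v (-i)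
  lattice i hi := c.lattice _ hi
  step i hi hi' := by
    have hi' : -(i + 1) ∈ c.dom := hi'
    obtain ⟨j, hj⟩ := c.step (-(i + 1)) hi' (by simpa using hi)
    rw [show -(i + 1) + 1 = -i by ring] at hj
    refine ⟨j, ?_⟩
    rcases hj with hj | hj
    · exact Or.inr (by rw [hj, add_sub_cancel_right])
    · exact Or.inl (by rw [hj, sub_add_cancel])
  noback i hi hi' := by
    have e : -(i + 1) = -i - 1 := by ring
    have e' : -(i - 1) = -i + 1 := by ring
    have hi : -(i - 1) ∈ c.dom := hi
    have hi' : -(i + 1) ∈ c.dom := hi'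
    rw [e'] at hi ⊢
    rw [e] at hi' ⊢
    exact (c.noback (-i) hi' hi).symm

variable {c}

lemma mem_reverse_dom {i : ℤ} : i ∈ c.reverse.dom ↔ -i ∈ c.dom := Iff.rfl

lemma reverse_v (i : ℤ) : c.reverse.v i = c.v (-i) := rfl

lemma conn_of_reverse {S T : Sym2 (Pt 3)} (h : c.reverse.conn S T) : c.conn S T := by
  obtain ⟨i, hi, hi', h⟩ := h
  rw [mem_reverse_dom] at hi hi'
  simp only [reverse_v] at h
  have e : -(i + 1) = -i - 1 := by ring
  have e' : -(i - 1) = -i + 1 := by ring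
  rw [e] at hi' h
  rw [e'] at hi h
  refine ⟨-i, hi', hi, ?_⟩
  rw [Sym2.eq_swap (a := c.v (-i - 1)), Sym2.eq_swap (a := c.v (-i)) (b := c.v (-i + 1))]
  tauto

lemma exists_next {i : ℤ} {x : Z3} (hi : i ∈ c.dom) (hi' : i + 1 ∈ c.dom)
    (hx : c.v i = emb x) : ∃ u, c.v (i + 1) = emb (x + vec u) := by
  obtain ⟨j, hj | hj⟩ := c.step i hi hi'
  · exact ⟨_, by rw [hj, hx, emb_add, uvec_eq]⟩
  · exact ⟨_, by rw [hj, hx, emb_add, sub_eq_add_neg, neg_uvec_eq]⟩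

lemma exists_prev {i : ℤ} {x : Z3} (hi : i - 1 ∈ c.dom) (hi' : i ∈ c.dom)
    (hx : c.v i = emb x) : ∃ u, c.v (i - 1) = emb (x + vec u) := by
  have := c.reverse.exists_next (i := -i) (x := x) (by rwa [mem_reverse_dom, _root_.neg_neg])
    (by rwa [mem_reverse_dom, neg_add', _root_.neg_neg]) (by rwa [reverse_v, _root_.neg_neg])
  rwa [reverse_v, neg_add', _root_.neg_neg] at this

lemma mem_dom_of_mid {i : ℤ} (hi : i - 1 ∈ c.dom) (hi' : i + 1 ∈ c.dom) : i ∈ c.dom :=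
  c.ordConn.out hi hi' ⟨by omega, by omega⟩

lemma conn_eq_seg {S T : Sym2 (Pt 3)} (h : c.conn S T) :
    ∃ x u v, u ≠ v ∧ S = seg x u ∧ T = seg x v := by
  obtain ⟨i, hi, hi', h⟩ := h
  have hi0 := mem_dom_of_mid hi hi'
  obtain ⟨x, hx⟩ := latt_iff.1 (c.lattice i hi0)
  obtain ⟨u, hu⟩ := exists_prev hi hi0 hx
  obtain ⟨v, hv⟩ := exists_next hi0 hi' hx
  have hne : u ≠ v := by
    rintro rfl
    exact c.noback i hi hi' (hv.trans hu.symm)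
  rw [hu, hv, hx, Sym2.eq_swap] at h
  rcases h with ⟨rfl, rfl⟩ | ⟨rfl, rfl⟩
  exacts [⟨x, u, v, hne, rfl, rfl⟩, ⟨x, v, u, hne.symm, rfl, rfl⟩]

lemma conn_symm {S T : Sym2 (Pt 3)} (h : c.conn S T) : c.conn T S := by
  obtain ⟨i, hi, hi', h⟩ := h
  exact ⟨i, hi, hi', h.symm⟩

lemma mem_segs_of_conn {S T : Sym2 (Pt 3)} (h : c.conn S T) : S ∈ c.segs := by
  obtain ⟨i, hi, hi', h⟩ := h
  have hi0 := mem_dom_of_mid hi hi'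
  rcases h with ⟨rfl, -⟩ | ⟨-, rfl⟩
  · exact ⟨i - 1, hi, by rwa [sub_add_cancel], by rw [sub_add_cancel]⟩
  · exact ⟨i, hi0, hi', rfl⟩

lemma segs_isSeg {S : Sym2 (Pt 3)} (h : S ∈ c.segs) : IsSeg S := by
  obtain ⟨i, hi, hi', rfl⟩ := h
  obtain ⟨x, hx⟩ := latt_iff.1 (c.lattice i hi)
  obtain ⟨u, hu⟩ := exists_next hi hi' hx
  exact isSeg_iff.2 ⟨x, u, by rw [hu, hx, seg]⟩

end Curve

/-- The connexion relation of a trace read at the integer points. -/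
def TConn (T : Trace 3) (x : Z3) (u v : Fin 6) : Prop := T.conn (seg x u) (seg x v)

lemma traceOf_conn_eq_seg {E : Set (Curve 3)} {S T : Sym2 (Pt 3)}
    (h : (traceOf E).conn S T) :
    ∃ x u v, u ≠ v ∧ S = seg x u ∧ T = seg x v ∧ TConn (traceOf E) x u v := by
  obtain ⟨c, hc, h'⟩ := h
  obtain ⟨x, u, v, huv, rfl, rfl⟩ := c.conn_eq_seg h'
  exact ⟨x, u, v, huv, rfl, rfl, c, hc, h'⟩

lemma traceOf_conn_iff {E : Set (Curve 3)} {S T : Sym2 (Pt 3)} :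
    (traceOf E).conn S T ↔ ∃ x u v, S = seg x u ∧ T = seg x v ∧ TConn (traceOf E) x u v := by
  constructor
  · intro h
    obtain ⟨x, u, v, -, h⟩ := traceOf_conn_eq_seg h
    exact ⟨x, u, v, h⟩
  · rintro ⟨x, u, v, rfl, rfl, h⟩
    exact h

lemma traceOf_conn_symm {E : Set (Curve 3)} {S T : Sym2 (Pt 3)}
    (h : (traceOf E).conn S T) : (traceOf E).conn T S := by
  obtain ⟨c, hc, h⟩ := h
  exact ⟨c, hc, c.conn_symm h⟩

/-- The block `ℬ₀` with integer vertices. -/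
def intB0 : List (List Z3) :=
  [ [(0, 0, 0), (0, -1, 0), (0, -1, -1), (0, 0, -1), (1, 0, -1),
     (1, -1, -1), (1, -1, 0), (1, 0, 0), (2, 0, 0)],
    [(0, 0, 0), (0, 0, 1), (0, 1, 1), (0, 1, 0), (-1, 1, 0), (-1, 1, 1),
     (-1, 0, 1), (-1, 0, 0), (-2, 0, 0)],
    [(0, 0, 0), (0, 0, -1), (-1, 0, -1), (-1, 0, 0), (-1, 1, 0),
     (-1, 1, -1), (0, 1, -1), (0, 1, 0), (0, 2, 0)],
    [(0, 0, 0), (1, 0, 0), (1, 0, 1), (0, 0, 1), (0, -1, 1), (1, -1, 1),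
     (1, -1, 0), (0, -1, 0), (0, -2, 0)],
    [(0, 0, 0), (-1, 0, 0), (-1, -1, 0), (0, -1, 0), (0, -1, 1),
     (-1, -1, 1), (-1, 0, 1), (0, 0, 1), (0, 0, 2)],
    [(0, 0, 0), (0, 1, 0), (1, 1, 0), (1, 0, 0), (1, 0, -1), (1, 1, -1),
     (0, 1, -1), (0, 0, -1), (0, 0, -2)] ]

/-- The symmetries that define the four blocks. -/
def intSym : Fin 4 → Z3 → Z3 :=
  ![id, fun p => (2, 2, 0) + (p.1, -p.2.1, -p.2.2), fun p => (2, 0, 2) + (p.1, p.2.2, -p.2.1),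
    fun p => (0, 2, 2) + (p.1, -p.2.2, p.2.1)]

lemma blockLists_eq (i : Fin 4) :
    blockLists i = intB0.map (List.map fun p => emb (intSym i p)) := by
  have h0 : B0 = intB0.map (List.map emb) := by
    simp [B0, CList, intB0, emb]
  have key (f : Pt 3 → Pt 3) (g : Z3 → Z3) (h : ∀ p, f (emb p) = emb (g p)) :
      B0.map (List.map f) = intB0.map (List.map fun p => emb (g p)) := by
    rw [h0, List.map_map]
    congr 1
    funext L
    simp [Function.comp_def, h]
  fin_cases i
  · exact h0
  · refine key _ (fun p => (2, 2, 0) + (p.1, -p.2.1, -p.2.2)) fun p => ?_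
    apply pt_ext <;> simp [emb, p3, toPt3, sigma3]
  · refine key _ (fun p => (2, 0, 2) + (p.1, p.2.2, -p.2.1)) fun p => ?_
    apply pt_ext <;> simp [emb, p3, toPt3, tau3]
  · refine key _ (fun p => (0, 2, 2) + (p.1, -p.2.2, p.2.1)) fun p => ?_
    apply pt_ext <;> simp [emb, p3, toPt3, ups3]

lemma intB0_length : ∀ M ∈ intB0, M.length = 9 := by decide

/-- The `j`-th vertex of a curve of the `i`-th block. -/
def vtx (i : Fin 4) (M : List Z3) (j : ℕ) : Z3 := intSym i (M.getD j 0)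

lemma vtx_pr : ∀ i, ∀ M ∈ intB0, ∀ j : Fin 7, ev (red (vtx i M (j + 1))) = false ∧
    ∃ u, vtx i M j = vtx i M (j + 1) + vec u ∧
      vtx i M (j + 2) = vtx i M (j + 1) + vec (pr (red (vtx i M (j + 1))) u) := by
  decide +kernel

lemma exists_vtx : ∀ r, ev r = false → ∀ u, ∃ i, ∃ M ∈ intB0, ∃ j : Fin 7,
    red (vtx i M (j + 1)) = r ∧
    (vtx i M j = vtx i M (j + 1) + vec u ∨ vtx i M j = vtx i M (j + 1) + vec (pr r u)) := by
  decide +kernel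

lemma red_eq_iff {x y : Z3} : red x = red y ↔ ∃ k, x = y + 4 * k := by
  constructor
  · intro h
    obtain ⟨a, b, c⟩ := x
    obtain ⟨a', b', c'⟩ := y
    simp only [red, RingHom.prodMap_def, RingHom.prod_apply, RingHom.comp_apply, RingHom.coe_fst,
      RingHom.coe_snd, Int.coe_castRingHom, Prod.mk.injEq] at h
    have key (a b : ℤ) (h : (a : ZMod 4) = b) : ∃ k, a = b + 4 * k := by
      obtain ⟨k, hk⟩ := (ZMod.intCast_eq_intCast_iff_dvd_sub a b 4).1 h
      exact ⟨-k, by push_cast at hk; omega⟩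
    obtain ⟨k1, rfl⟩ := key _ _ h.1
    obtain ⟨k2, rfl⟩ := key _ _ h.2.1
    obtain ⟨k3, rfl⟩ := key _ _ h.2.2
    exact ⟨(k1, k2, k3), rfl⟩
  · rintro ⟨k, rfl⟩
    exact red_add_four _ _

lemma getD_block {i : Fin 4} {M : List Z3} {j : ℕ} (hj : j < M.length) :
    (M.map fun p => emb (intSym i p)).getD j 0 = emb (vtx i M j) := by
  simp [vtx, List.getD_eq_getElem?_getD, hj]

lemma CTrace_conn_iff {S T : Sym2 (Pt 3)} : CTrace.conn S T ↔
    ∃ x u, ¬ 2 ∣ x ∧ S = seg x u ∧ T = seg x (pr (red x) u) := by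
  have triple (i : Fin 4) (M : List Z3) (j : ℕ) (x k : Z3) (u : Fin 6) (hj : j < 7)
      (hM : M ∈ intB0) (hx : x = vtx i M (j + 1) + 4 * k)
      (hu : vtx i M j = vtx i M (j + 1) + vec u) :
      s(emb (vtx i M j + 4 * k), emb (vtx i M (j + 1) + 4 * k)) = seg x u ∧
      s(emb (vtx i M (j + 1) + 4 * k), emb (vtx i M (j + 2) + 4 * k)) =
        seg x (pr (red x) u) := by
    obtain ⟨-, u', hu', hv⟩ := vtx_pr i M hM ⟨j, hj⟩
    simp only at hu' hv
    obtain rfl : u = u' := vec_injective (add_left_cancel (hu.symm.trans hu'))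
    rw [hx, red_add_four, Sym2.eq_swap, seg, seg, hu, hv]
    constructor <;> rw [add_right_comm]
  have tmap (p q k : Z3) : Sym2.map (fun p => p + (4 : ℝ) • emb k) s(emb p, emb q) =
      s(emb (p + 4 * k), emb (q + 4 * k)) := by
    rw [Sym2.map_mk, ← emb_four_mul, ← emb_add, ← emb_add]
  constructor
  · rintro ⟨u, hu, i, M', hM', A, B, ⟨j, hj, h⟩, rfl, rfl⟩
    obtain ⟨k, rfl⟩ := latt_iff.1 hu
    rw [blockLists_eq, List.mem_map] at hM'
    obtain ⟨M, hM, rfl⟩ := hM'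
    rw [List.length_map] at hj
    have hl := intB0_length M hM
    rw [getD_block (by omega), getD_block (by omega), getD_block (by omega)] at h
    obtain ⟨hodd, u, hu, -⟩ := vtx_pr i M hM ⟨j, by omega⟩
    have hodd' : ev (red (vtx i M (j + 1) + 4 * k)) = false := by rwa [red_add_four]
    obtain ⟨h1, h2⟩ := triple i M j _ k u (by omega) hM rfl hu
    rcases h with ⟨rfl, rfl⟩ | ⟨rfl, rfl⟩
    · refine ⟨_, u, (ev_red_false _).1 hodd', ?_, ?_⟩
      · rw [tmap, h1]
      · rw [tmap, h2]
    · refine ⟨vtx i M (j + 1) + 4 * k, pr (red (vtx i M (j + 1) + 4 * k)) u,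
        (ev_red_false _).1 hodd', ?_, ?_⟩
      · rw [tmap, h2]
      · rw [tmap, h1, (pr_pr _ hodd' u).1]
  · rintro ⟨x, u, hx, rfl, rfl⟩
    have hodd := (ev_red_false x).2 hx
    obtain ⟨i, M, hM, j, hr, h⟩ := exists_vtx _ hodd u
    obtain ⟨k, hk⟩ := red_eq_iff.1 hr.symm
    have hl := intB0_length M hM
    have hj := j.2
    refine ⟨emb k, latt_iff.2 ⟨k, rfl⟩, i, M.map fun p => emb (intSym i p), ?_, ?_⟩
    · rw [blockLists_eq]
      exact List.mem_map_of_mem hM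
    rcases h with h | h
    · obtain ⟨h1, h2⟩ := triple i M j x k u hj hM hk h
      refine ⟨_, _, ⟨j, by rw [List.length_map]; omega, Or.inl ⟨rfl, rfl⟩⟩, ?_, ?_⟩
      · rw [getD_block (by omega), getD_block (by omega), tmap, h1]
      · rw [getD_block (by omega), getD_block (by omega), tmap, h2]
    · obtain ⟨h1, h2⟩ := triple i M j x k _ hj hM hk h
      rw [(pr_pr _ hodd u).1] at h2
      refine ⟨_, _, ⟨j, by rw [List.length_map]; omega, Or.inr ⟨rfl, rfl⟩⟩, ?_, ?_⟩
      · rw [getD_block (by omega), getD_block (by omega), tmap, h2]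
      · rw [getD_block (by omega), getD_block (by omega), tmap, h1]

lemma phi_neg_word (y : Z3) (u : Fin 6) :
    neg (word (red y) u 7) = phi (red (y + vec u)) (neg u) := by
  rw [word_last, neg_neg, map_add]

lemma iterate_st (y : Z3) (u : Fin 6) (k : ℕ) :
    (red (st^[k] (2 * y, phi (red y) u)).1, (st^[k] (2 * y, phi (red y) u)).2) =
      st4^[k] (2 * red y, phi (red y) u) := by
  induction k with
  | zero => simp only [Function.iterate_zero, id_eq, map_mul, map_ofNat]
  | succ k ih =>
    rw [Function.iterate_succ_apply', Function.iterate_succ_apply', ← ih]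
    simp only [st, st4, map_add]

lemma st_odd (y : Z3) (u : Fin 6) {k : ℕ} (hk : k < 7) :
    ¬ 2 ∣ (st^[k + 1] (2 * y, phi (red y) u)).1 := by
  rw [← ev_red_false, ← ev_word (red y) u k hk, ← iterate_st]

lemma st_last (y : Z3) (u : Fin 6) :
    (st^[7] (2 * y, phi (red y) u)).2 = word (red y) u 7 ∧
    (st^[7] (2 * y, phi (red y) u)).1 + vec (word (red y) u 7) = 2 * (y + vec u) := by
  have h2 (k : ℕ) : (st^[k] (2 * y, phi (red y) u)).2 = word (red y) u k := by
    rw [word, ← iterate_st]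
  have h1 (k : ℕ) : (st^[k + 1] (2 * y, phi (red y) u)).1 =
      (st^[k] (2 * y, phi (red y) u)).1 + vec (word (red y) u k) := by
    rw [Function.iterate_succ_apply', ← h2 k, st]
  refine ⟨h2 7, ?_⟩
  rw [h1 6, h1 5, h1 4, h1 3, h1 2, h1 1, h1 0, mul_add, ← word_sum (red y) u]
  simp only [Function.iterate_zero, id_eq]
  ring

/-- The curve `c` is the curve of `𝒞` joining `2y` to `2y + 2u`. -/
structure Joins (c : Curve 3) (y : Z3) (u : Fin 6) : Prop where
  endpt : ∀ p, c.IsEndpt p ↔ p = emb (2 * y) ∨ p = emb (2 * (y + vec u))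
  endSeg : ∀ p S, c.endSegAt p S ↔ (p = emb (2 * y) ∧ S = seg (2 * y) (phi (red y) u)) ∨
    (p = emb (2 * (y + vec u)) ∧ S = seg (2 * (y + vec u)) (phi (red (y + vec u)) (neg u)))

section Covering

variable {C3 : Set (Curve 3)}

lemma conn_of_mem (hC3 : traceOf C3 = CTrace) {c : Curve 3} (hc : c ∈ C3)
    {S T : Sym2 (Pt 3)} (h : c.conn S T) : CTrace.conn S T := by
  rw [← hC3]
  exact ⟨c, hc, h⟩

lemma conn_mid_odd (hC3 : traceOf C3 = CTrace) {c : Curve 3} (hc : c ∈ C3) {i : ℤ} {x : Z3}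
    (hi : i - 1 ∈ c.dom) (hi' : i + 1 ∈ c.dom) (hx : c.v i = emb x) : ¬ 2 ∣ x := by
  have hi0 := Curve.mem_dom_of_mid hi hi'
  obtain ⟨u, hu⟩ := Curve.exists_prev hi hi0 hx
  obtain ⟨v, hv⟩ := Curve.exists_next hi0 hi' hx
  have hne : u ≠ v := by
    rintro rfl
    exact c.noback i hi hi' (hv.trans hu.symm)
  have hconn : c.conn (seg x u) (seg x v) := by
    refine ⟨i, hi, hi', Or.inl ?_⟩
    rw [hu, hv, hx, Sym2.eq_swap]
    exact ⟨rfl, rfl⟩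
  obtain ⟨y, w, hy, h1, h2⟩ := CTrace_conn_iff.1 (conn_of_mem hC3 hc hconn)
  rwa [(seg_pair h1 h2 hne).1]

lemma step_odd (hC3 : traceOf C3 = CTrace) (hD : DisjSA C3) {c : Curve 3} (hc : c ∈ C3)
    {i : ℤ} {x : Z3} {u : Fin 6} (hi : i ∈ c.dom) (hi' : i + 1 ∈ c.dom) (hx : c.v i = emb x)
    (hu : c.v (i + 1) = emb (x + vec u)) (hodd : ¬ 2 ∣ x + vec u) :
    i + 2 ∈ c.dom ∧
      c.v (i + 2) = emb (x + vec u + vec (pr (red (x + vec u)) (neg u))) := by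
  have hT : CTrace.conn (seg (x + vec u) (neg u))
      (seg (x + vec u) (pr (red (x + vec u)) (neg u))) :=
    CTrace_conn_iff.2 ⟨_, _, hodd, rfl, rfl⟩
  have hpr := (pr_pr _ ((ev_red_false _).2 hodd) (neg u)).2
  set w := pr (red (x + vec u)) (neg u)
  rw [seg_neg] at hT
  have hS : seg x u = s(c.v i, c.v (i + 1)) := by rw [hx, hu, seg]
  obtain ⟨d, hd, hdc⟩ : (traceOf C3).conn (seg x u) (seg (x + vec u) w) := by rwa [hC3]
  have hsame : SameCurve c d := by
    by_contra hne
    exact hD.2 c hc d hd hne _ ⟨i, hi, hi', hS⟩ (Curve.mem_segs_of_conn hdc)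
  rw [← hsame.2] at hdc
  obtain ⟨j, hj, hj', ⟨h1, h2⟩ | ⟨h1, h2⟩⟩ := hdc
  · have hj0 := Curve.mem_dom_of_mid hj hj'
    have := hD.1 c hc i (j - 1) hi hi' hj (by rwa [sub_add_cancel])
      (by rw [sub_add_cancel, ← hS, h1])
    obtain rfl : j = i + 1 := by omega
    rw [add_assoc, show (1 : ℤ) + 1 = 2 from rfl] at hj' h2
    refine ⟨hj', ?_⟩
    rw [hu, seg, Sym2.congr_right] at h2
    exact h2.symm
  · have hj0 := Curve.mem_dom_of_mid hj hj'
    obtain rfl := hD.1 c hc i j hi hi' hj0 hj' (by rw [← hS, h2])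
    rw [hx, seg, Sym2.eq_iff, emb_injective.eq_iff, emb_injective.eq_iff] at h1
    exfalso
    rcases h1 with ⟨-, h⟩ | ⟨h, -⟩
    · apply hpr
      apply vec_injective
      rw [vec_neg, eq_neg_iff_add_eq_zero, add_comm]
      rw [add_assoc] at h
      exact left_eq_add.1 h.symm
    · exact vec_ne_zero u (left_eq_add.1 h.symm)

lemma exists_joins (hC3 : traceOf C3 = CTrace) (hH : SatH C3 2 4) {c : Curve 3} (hc : c ∈ C3) :
    ∃ y u, Joins c y u := by
  obtain ⟨-, -, -, ⟨hD, -⟩, hE, -, -⟩ := hH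
  obtain ⟨hfin, x, i, -, hx2, -, -, hend⟩ := hE c hc
  obtain ⟨i0, hi0, hi0'⟩ := c.nontriv
  obtain ⟨m, hm, hmin⟩ := hfin.exists_minimal ⟨i0, hi0⟩
  replace hmin (j : ℤ) (hj : j ∈ c.dom) : m ≤ j := by
    by_contra h
    have := hmin hj (by omega)
    omega
  have hm1 : m - 1 ∉ c.dom := fun h => by have := hmin _ h; omega
  have hm' : m + 1 ∈ c.dom := by
    have := hmin _ hi0
    exact c.ordConn.out hm hi0' ⟨by omega, by omega⟩
  obtain ⟨y, hy⟩ : ∃ y, c.v m = emb (2 * y) := by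
    obtain ⟨y, rfl⟩ := inLat_two_iff.1 hx2
    rcases hend (c.v m) ⟨m, hm, rfl, Or.inl hm1⟩ with h | h
    · exact ⟨y, h⟩
    · refine ⟨y + vec (Fin.castLE (by norm_num) i), ?_⟩
      rw [h, mul_add, emb_add, emb_two_mul (vec _), uvec_eq]
      norm_num
  obtain ⟨u', hu'⟩ := Curve.exists_next hm hm' hy
  obtain ⟨u, rfl⟩ : ∃ u, u' = phi (red y) u := ⟨_, (phi_phi _ _).symm⟩
  have walk : ∀ k : ℕ, k ≤ 7 → m + k ∈ c.dom ∧ m + k + 1 ∈ c.dom ∧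
      c.v (m + k) = emb (st^[k] (2 * y, phi (red y) u)).1 ∧
      c.v (m + k + 1) = emb ((st^[k] (2 * y, phi (red y) u)).1 +
        vec (st^[k] (2 * y, phi (red y) u)).2) := by
    intro k
    induction k with
    | zero => exact fun _ => ⟨by simpa, by simpa, by simpa, by simpa⟩
    | succ k ih =>
      intro hk
      obtain ⟨h1, h2, h3, h4⟩ := ih (by omega)
      have hodd := st_odd y u (k := k) (by omega)
      rw [Function.iterate_succ_apply'] at hodd
      obtain ⟨h5, h6⟩ := step_odd hC3 hD hc h1 h2 h3 h4 hodd
      rw [Function.iterate_succ_apply']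
      push_cast
      rw [← add_assoc, add_assoc (m + k), show (1 : ℤ) + 1 = 2 from rfl]
      exact ⟨h2, h5, h4, h6⟩
  obtain ⟨h7, h8, h7v, h8v⟩ := walk 7 le_rfl
  rw [(st_last y u).1, (st_last y u).2] at h8v
  have e8 : m + (7 : ℕ) + 1 = m + 8 := by push_cast; ring
  have e7 : m + 8 - 1 = m + (7 : ℕ) := by push_cast; ring
  rw [e8] at h8 h8v
  have h9 : m + 8 + 1 ∉ c.dom := fun h =>
    conn_mid_odd hC3 hc (by rwa [e7]) h h8v (dvd_mul_right _ _)
  have hmax (j : ℤ) (hj : j ∈ c.dom) : j ≤ m + 8 := by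
    by_contra h
    exact h9 (c.ordConn.out hm hj ⟨by omega, by omega⟩)
  have first (j : ℤ) (hj : j ∈ c.dom) (h : j - 1 ∉ c.dom) : j = m := by
    have := hmin j hj
    by_contra hne
    exact h (c.ordConn.out hm hj ⟨by omega, by omega⟩)
  have last (j : ℤ) (hj : j ∈ c.dom) (h : j + 1 ∉ c.dom) : j = m + 8 := by
    have := hmax j hj
    by_contra hne
    exact h (c.ordConn.out hj h8 ⟨by omega, by omega⟩)
  have hfirst : s(c.v m, c.v (m + 1)) = seg (2 * y) (phi (red y) u) := by rw [hy, hu', seg]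
  have hlast : s(c.v (m + 8 - 1), c.v (m + 8)) =
      seg (2 * (y + vec u)) (phi (red (y + vec u)) (neg u)) := by
    rw [e7, h7v, h8v, ← phi_neg_word, ← (st_last y u).2, seg_neg, seg]
  refine ⟨y, u, fun p => ⟨?_, ?_⟩, fun p S => ⟨?_, ?_⟩⟩
  · rintro ⟨j, hj, rfl, h | h⟩
    · exact Or.inl (by rw [first j hj h, hy])
    · exact Or.inr (by rw [last j hj h, h8v])
  · rintro (rfl | rfl)
    exacts [⟨m, hm, hy.symm, Or.inl hm1⟩, ⟨_, h8, h8v.symm, Or.inr h9⟩]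
  · rintro ⟨j, hj, rfl, ⟨h, -, rfl⟩ | ⟨h, -, rfl⟩⟩
    · obtain rfl := first j hj h
      exact Or.inl ⟨hy, hfirst⟩
    · obtain rfl := last j hj h
      exact Or.inr ⟨h8v, hlast⟩
  · rintro (⟨rfl, rfl⟩ | ⟨rfl, rfl⟩)
    · exact ⟨m, hm, hy.symm, Or.inl ⟨hm1, hm', hfirst.symm⟩⟩
    · exact ⟨_, h8, h8v.symm, Or.inr ⟨h9, by rwa [e7], hlast.symm⟩⟩

lemma Joins.endSegAt {c : Curve 3} {y : Z3} {u : Fin 6} (h : Joins c y u) {x : Z3} {v : Fin 6}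
    (hx : c.IsEndpt (emb (2 * x))) (hv : c.IsEndpt (emb (2 * (x + vec v)))) (S : Sym2 (Pt 3)) :
    c.endSegAt (emb (2 * x)) S ↔ S = seg (2 * x) (phi (red x) v) := by
  rw [h.endpt, emb_injective.eq_iff, emb_injective.eq_iff, two_mul_inj, two_mul_inj] at hx hv
  rw [h.endSeg, emb_injective.eq_iff, emb_injective.eq_iff, two_mul_inj, two_mul_inj]
  have hne (z : Z3) (w : Fin 6) : z ≠ z + vec w := fun h => vec_ne_zero w (left_eq_add.1 h)
  rcases hx with rfl | rfl
  · rcases hv with hv | hv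
    · exact absurd hv.symm (hne x v)
    · obtain rfl := vec_injective (add_left_cancel hv)
      simp [hne]
  · rcases hv with hv | hv
    · obtain rfl : v = neg u := by
        apply vec_injective
        rw [vec_neg, eq_neg_iff_add_eq_zero, add_comm]
        rw [add_assoc] at hv
        exact left_eq_add.1 hv.symm
      simp [(hne y u).symm]
    · exact absurd hv.symm (hne _ v)

lemma exists_curve (hH : SatH C3 2 4) (x : Z3) (u : Fin 6) :
    ∃ c ∈ C3, c.IsEndpt (emb (2 * x)) ∧ c.IsEndpt (emb (2 * (x + vec u))) := by
  obtain ⟨-, -, -, -, -, hE, -⟩ := hH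
  have key (z : Z3) (i : Fin 3) : ∃ c ∈ C3, c.IsEndpt (emb (2 * z)) ∧
      c.IsEndpt (emb (2 * (z + vec (Fin.castLE (by norm_num) i)))) := by
    have := (hE (emb (2 * z)) i (latt_iff.2 ⟨_, rfl⟩) (inLat_two_iff.2 ⟨_, rfl⟩)).1
    rw [mul_add, emb_add, emb_two_mul (vec _), ← uvec_eq]
    exact_mod_cast this
  obtain ⟨i, rfl | rfl⟩ := dir_cases u
  · exact key x i
  · obtain ⟨c, hc, h1, h2⟩ := key (x + vec (neg (Fin.castLE (by norm_num) i))) i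
    rw [vec_neg, neg_add_cancel_right] at h2
    rw [vec_neg] at h1 ⊢
    exact ⟨c, hc, h2, h1⟩

lemma exists_mem_segs (hH : SatH C3 2 4) {S : Sym2 (Pt 3)} (hS : IsSeg S) :
    ∃ c ∈ C3, S ∈ c.segs := by
  obtain ⟨-, -, -, ⟨-, hcov⟩, -⟩ := hH
  refine (hcov S hS ?_).1
  obtain ⟨x, i, -, rfl⟩ := hS
  exact ⟨x, ⟨_, _, rfl, 0, le_rfl, zero_le_one, by simp⟩, trivial⟩

lemma traceOf_segs_isSeg {E : Set (Curve 3)} {S : Sym2 (Pt 3)} (h : S ∈ (traceOf E).segs) :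
    IsSeg S := by
  obtain ⟨c, -, h⟩ := h
  exact c.segs_isSeg h

lemma TConn_traceOf_ne {E : Set (Curve 3)} {x : Z3} {u v : Fin 6}
    (h : TConn (traceOf E) x u v) : u ≠ v := by
  rintro rfl
  obtain ⟨y, u', v', huv, h1, h2, -⟩ := traceOf_conn_eq_seg h
  have h3 := h1.symm.trans h2
  exact huv (seg_injective y h3)

lemma TConn_traceOf_symm {E : Set (Curve 3)} {x : Z3} {u v : Fin 6}
    (h : TConn (traceOf E) x u v) : TConn (traceOf E) x v u :=
  traceOf_conn_symm h

lemma ConvTrace_conn_iff (hC3 : traceOf C3 = CTrace) (hH : SatH C3 2 4) {B : Set (Curve 3)}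
    (hB : (traceOf B).segs = {S | IsSeg S}) {S T : Sym2 (Pt 3)} :
    (ConvTrace 2 C3 B).conn S T ↔ CTrace.conn S T ∨ ∃ x u v, TConn (traceOf B) x u v ∧
      S = seg (2 * x) (phi (red x) u) ∧ T = seg (2 * x) (phi (red x) v) := by
  have e (x : Z3) : ((2 : ℕ) : ℝ) • emb x = emb (2 * x) := by
    rw [emb_two_mul]
    norm_num
  constructor
  · rintro (⟨a, b, -, c, hc, -, -, h⟩ | ⟨a, b, d, hconn, c, hc, c', hc', ha, hb, hb', hd, h⟩)
    · exact Or.inl (conn_of_mem hC3 hc h)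
    · obtain ⟨x, u, v, huv, h1, h2, hT⟩ := traceOf_conn_eq_seg hconn
      have hu := vec_ne_zero u
      have hv := vec_ne_zero v
      obtain ⟨rfl, rfl, rfl⟩ : b = emb x ∧ a = emb (x + vec u) ∧ d = emb (x + vec v) := by
        rw [seg, Sym2.eq_iff] at h1 h2
        rcases h1 with ⟨rfl, rfl⟩ | ⟨rfl, rfl⟩
        · simp [emb_injective.eq_iff, hu, huv, vec_injective.eq_iff] at h2
        · rcases h2 with h2 | h2
          · exact ⟨rfl, rfl, h2.2⟩
          · simp [emb_injective.eq_iff, hv] at h2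
      rw [e] at ha hb hb' hd h
      obtain ⟨y, w, hj⟩ := exists_joins hC3 hH hc
      obtain ⟨y', w', hj'⟩ := exists_joins hC3 hH hc'
      simp only [hj.endSegAt hb ha, hj'.endSegAt hb' hd] at h
      rcases h with h | h
      · exact Or.inr ⟨x, u, v, hT, h⟩
      · exact Or.inr ⟨x, v, u, TConn_traceOf_symm hT, h.symm⟩
  · rintro (h | ⟨x, u, v, hT, rfl, rfl⟩)
    · rw [← hC3] at h
      obtain ⟨c, hc, h⟩ := h
      obtain ⟨y, w, hj⟩ := exists_joins hC3 hH hc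
      refine Or.inl ⟨emb y, emb (y + vec w), ?_, c, hc, ?_, ?_, h⟩
      · rw [hB]
        exact isSeg_iff.2 ⟨y, w, rfl⟩
      · rw [e, hj.endpt]
        exact Or.inl rfl
      · rw [e, hj.endpt]
        exact Or.inr rfl
    · obtain ⟨c, hc, h1, h2⟩ := exists_curve hH x u
      obtain ⟨c', hc', h1', h2'⟩ := exists_curve hH x v
      obtain ⟨y, w, hj⟩ := exists_joins hC3 hH hc
      obtain ⟨y', w', hj'⟩ := exists_joins hC3 hH hc'
      refine Or.inr ⟨emb (x + vec u), emb x, emb (x + vec v), ?_, c, hc, c', hc', ?_⟩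
      · rw [Sym2.eq_swap]
        exact hT
      · rw [e, e, e]
        exact ⟨h2, h1, h1', h2', Or.inl ⟨(hj.endSegAt h1 h2 _).2 rfl, (hj'.endSegAt h1' h2' _).2 rfl⟩⟩

lemma ConvTrace_segs (hC3 : traceOf C3 = CTrace) (hH : SatH C3 2 4) {B : Set (Curve 3)}
    (hB : (traceOf B).segs = {S | IsSeg S}) : (ConvTrace 2 C3 B).segs = {S | IsSeg S} := by
  ext S
  constructor
  · rintro ⟨a, b, -, c, hc, -, -, h⟩
    exact c.segs_isSeg h
  · intro h
    obtain ⟨c, hc, h⟩ := exists_mem_segs hH h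
    obtain ⟨y, w, hj⟩ := exists_joins hC3 hH hc
    have e (x : Z3) : ((2 : ℕ) : ℝ) • emb x = emb (2 * x) := by
      rw [emb_two_mul]
      norm_num
    refine ⟨emb y, emb (y + vec w), ?_, c, hc, ?_, ?_, h⟩
    · rw [hB]
      exact isSeg_iff.2 ⟨y, w, rfl⟩
    · rw [e, hj.endpt]
      exact Or.inl rfl
    · rw [e, hj.endpt]
      exact Or.inr rfl

variable {P : ℕ → Set (Curve 3)}

lemma powers_segs (hC3 : traceOf C3 = CTrace) (hH : SatH C3 2 4) (hP : PowersOf C3 2 P)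
    (n : ℕ) : (traceOf (P n)).segs = {S | IsSeg S} := by
  induction n with
  | zero => rw [hP.2.1]; rfl
  | succ n ih => rw [hP.2.2, ConvTrace_segs hC3 hH ih]

lemma powers_conn (hC3 : traceOf C3 = CTrace) (hH : SatH C3 2 4) (hP : PowersOf C3 2 P)
    (n : ℕ) : ∀ x u v, TConn (traceOf (P n)) x u v ↔ Q n x u v := by
  induction n with
  | zero =>
    intro x u v
    rw [hP.2.1]
    exact Iff.rfl
  | succ n ih =>
    intro x u v
    rw [hP.2.2, TConn, ConvTrace_conn_iff hC3 hH (powers_segs hC3 hH hP n), CTrace_conn_iff, Q]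
    refine or_congr ⟨?_, ?_⟩ ⟨?_, ?_⟩
    · rintro ⟨y, w, hy, h1, h2⟩
      have hy' := (ev_red_false y).2 hy
      obtain ⟨rfl, rfl, h⟩ := seg_pair h1.symm h2.symm (pr_pr _ hy' w).2.symm
      exact ⟨hy', h⟩
    · rintro ⟨h, rfl⟩
      exact ⟨x, u, (ev_red_false x).1 h, rfl, rfl⟩
    · rintro ⟨y, u', v', h, h1, h2⟩
      have hne : phi (red y) u' ≠ phi (red y) v' := fun h' => by
        have := congrArg (phi (red y)) h'
        rw [phi_phi, phi_phi] at this
        exact TConn_traceOf_ne h this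
      obtain ⟨rfl, rfl, rfl⟩ := seg_pair h1.symm h2.symm hne
      refine ⟨y, rfl, ?_⟩
      rwa [phi_phi, phi_phi, ← ih]
    · rintro ⟨y, rfl, h⟩
      refine ⟨y, _, _, (ih _ _ _).2 h, ?_, ?_⟩ <;> rw [phi_phi]

lemma hat_conn (hC3 : traceOf C3 = CTrace) (hH : SatH C3 2 4) (hP : PowersOf C3 2 P)
    (x : Z3) (u v : Fin 6) : TConn (hatTrace P) x u v ↔ QLim x u v :=
  exists_congr fun n => powers_conn hC3 hH hP n x u v

lemma hat_segs (hC3 : traceOf C3 = CTrace) (hH : SatH C3 2 4) (hP : PowersOf C3 2 P) :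
    (hatTrace P).segs = {S | IsSeg S} := by
  ext S
  simp [hatTrace, powers_segs hC3 hH hP]

lemma Rx_iff (hC3 : traceOf C3 = CTrace) (hH : SatH C3 2 4) (hP : PowersOf C3 2 P)
    (x : Z3) (u v : Fin 6) : Rx P (emb x) (emb (vec u)) (emb (vec v)) ↔ QLim x u v := by
  rw [← hat_conn hC3 hH hP, TConn, Rx, seg, seg, emb_add, emb_add]

end Covering

lemma exists_not_two_pow_dvd {x : Z3} (hx : x ≠ 0) : ∃ n, ¬ 2 ^ n ∣ x := by
  by_contra! h
  have key (a : ℤ) (ha : ∀ n : ℕ, (2 : ℤ) ^ n ∣ a) : a = 0 := by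
    by_contra hne
    have h1 := Int.natAbs_dvd_natAbs.2 (ha a.natAbs)
    rw [Int.natAbs_pow] at h1
    have h2 := Nat.le_of_dvd (Int.natAbs_pos.2 hne) h1
    exact absurd h2 (not_le.2 (Nat.lt_two_pow_self))
  apply hx
  refine Prod.ext (key _ fun n => ?_) (Prod.ext (key _ fun n => ?_) (key _ fun n => ?_))
  all_goals
    obtain ⟨z, rfl⟩ := h n
  exacts [⟨z.1, rfl⟩, ⟨z.2.1, rfl⟩, ⟨z.2.2, rfl⟩]

lemma QLim_odd {x : Z3} (hx : ¬ 2 ∣ x) (u v : Fin 6) : QLim x u v ↔ pr (red x) u = v := by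
  rw [QLim_iff (n := 1) (by rwa [pow_one]), Q_odd hx]

lemma QLim_two_mul (y : Z3) (u v : Fin 6) :
    QLim (2 * y) u v ↔ QLim y (phi (red y) u) (phi (red y) v) := by
  constructor
  · rintro ⟨n, h⟩
    cases n with
    | zero => exact h.elim
    | succ n => exact ⟨n, (Q_two_mul y u v).1 h⟩
  · rintro ⟨n, h⟩
    exact ⟨n + 1, (Q_two_mul y u v).2 h⟩

lemma exists_pairing (n : ℕ) : ∀ x : Z3, ¬ 2 ^ n ∣ x → ∃ f : Fin 6 → Fin 6,
    (∀ u, f (f u) = u ∧ f u ≠ u) ∧ ∀ u v, QLim x u v ↔ f u = v := by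
  induction n with
  | zero => simp
  | succ n ih =>
    intro x hx
    by_cases h : 2 ∣ x
    · obtain ⟨y, rfl⟩ := h
      rw [two_pow_dvd_two_mul] at hx
      obtain ⟨f, hf, hq⟩ := ih y hx
      refine ⟨fun u => phi (red y) (f (phi (red y) u)), fun u => ⟨?_, fun h => ?_⟩, fun u v => ?_⟩
      · simp only [phi_phi, hf]
      · apply (hf (phi (red y) u)).2
        simp only at h
        rw [← phi_phi (red y) (f _), h]
      · rw [QLim_two_mul, hq]
        simp only
        constructor
        · intro h
          rw [h, phi_phi]
        · rintro rfl
          rw [phi_phi]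
    · exact ⟨pr (red x), pr_pr _ ((ev_red_false x).2 h), QLim_odd h⟩

/-- The relation between vectors associated with a relation between directions. -/
def liftRel (K : Fin 6 → Fin 6 → Prop) (p q : Pt 3) : Prop :=
  ∃ u v, K u v ∧ p = emb (vec u) ∧ q = emb (vec v)

lemma emb_vec_injective : Function.Injective fun u => emb (vec u) :=
  emb_injective.comp vec_injective

lemma liftRel_emb {K : Fin 6 → Fin 6 → Prop} {u v : Fin 6} :
    liftRel K (emb (vec u)) (emb (vec v)) ↔ K u v := by
  constructor
  · rintro ⟨u', v', h, hu, hv⟩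
    rwa [emb_vec_injective hu, emb_vec_injective hv]
  · exact fun h => ⟨u, v, h, rfl, rfl⟩

lemma isPairing_liftRel {x : Z3} (hx : x ≠ 0) : IsPairing (liftRel (QLim x)) := by
  obtain ⟨n, hn⟩ := exists_not_two_pow_dvd hx
  obtain ⟨f, hf, hq⟩ := exists_pairing n x hn
  refine ⟨?_, ?_, ?_, ?_⟩
  · rintro p q ⟨u, v, h, rfl, rfl⟩
    rw [liftRel_emb, hq, ← (hq u v).1 h, (hf u).1]
  · rintro p q ⟨u, v, h, rfl, rfl⟩
    exact ⟨isDir_iff.2 ⟨u, rfl⟩, isDir_iff.2 ⟨v, rfl⟩⟩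
  · rintro p ⟨u, v, h, rfl, hv⟩
    obtain rfl := emb_vec_injective hv
    exact (hf u).2 ((hq u u).1 h)
  · intro p hp
    obtain ⟨u, rfl⟩ := isDir_iff.1 hp
    refine ⟨emb (vec (f u)), liftRel_emb.2 ((hq _ _).2 rfl), ?_⟩
    rintro q ⟨u', v, h, hu, rfl⟩
    rw [← emb_vec_injective hu] at h
    rw [(hq u v).1 h]

/-- The permutation `θ` of the directions. -/
def theta : Fin 6 → Fin 6 := ![4, 5, 3, 2, 0, 1]

lemma theta_theta : ∀ u, theta (theta u) = u := by decide

lemma phi_two_mul : ∀ r u, phi (2 * r) u = theta u := by decide +kernel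

lemma theta3_emb (u : Fin 6) : theta3 (emb (vec u)) = emb (vec (theta u)) := by
  have h0 : uvec 3 0 = emb (vec 0) := uvec_eq 0
  have h1 : uvec 3 1 = emb (vec 1) := uvec_eq 1
  have h2 : uvec 3 2 = emb (vec 2) := uvec_eq 2
  have h3 : -emb (vec 0) = emb (vec 3) := by rw [← emb_neg]; rfl
  have h4 : -emb (vec 1) = emb (vec 4) := by rw [← emb_neg]; rfl
  have h5 : -emb (vec 2) = emb (vec 5) := by rw [← emb_neg]; rfl
  rw [theta3, h0, h1, h2, h3, h4, h5]
  simp only [emb_injective.eq_iff, vec_injective.eq_iff]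
  fin_cases u <;> simp [theta]

lemma theta3_eq_iff {p : Pt 3} {u : Fin 6} :
    theta3 p = emb (vec u) ↔ p = emb (vec (theta u)) := by
  constructor
  · intro h
    by_cases hp : IsDir p
    · obtain ⟨v, rfl⟩ := isDir_iff.1 hp
      rw [theta3_emb] at h
      rw [← emb_vec_injective h, theta_theta]
    · have hne : theta3 p = p := by
        have h1 (i : Fin 3) : p ≠ uvec 3 i := fun h => hp ⟨i, Or.inl h⟩
        have h2 (i : Fin 3) : p ≠ -uvec 3 i := fun h => hp ⟨i, Or.inr h⟩
        rw [theta3, if_neg (h1 0), if_neg (h2 1), if_neg (h1 1), if_neg (h2 2), if_neg (h1 2),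
          if_neg (h2 0)]
      exact absurd (isDir_iff.2 ⟨u, hne.symm.trans h⟩) hp
  · rintro rfl
    rw [theta3_emb, theta_theta]

lemma Rtheta_liftRel (K : Fin 6 → Fin 6 → Prop) :
    Rtheta (liftRel K) = liftRel fun u v => K (theta u) (theta v) := by
  ext p q
  constructor
  · rintro ⟨u, v, h, hp, hq⟩
    exact ⟨theta u, theta v, by simpa only [theta_theta] using h, theta3_eq_iff.1 hp,
      theta3_eq_iff.1 hq⟩
  · rintro ⟨u, v, h, rfl, rfl⟩
    exact ⟨theta u, theta v, h, theta3_emb u, theta3_emb v⟩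

lemma QLim_even (n : ℕ) : ∀ x : Z3, ¬ 2 ^ n ∣ x → 2 ∣ x → ∃ y, ¬ 2 ∣ y ∧
    ((∀ u v, QLim x u v ↔ QLim (2 * y) u v) ∨
      ∀ u v, QLim x u v ↔ QLim (2 * y) (theta u) (theta v)) := by
  induction n with
  | zero => simp
  | succ n ih =>
    rintro x hx ⟨z, rfl⟩
    rw [two_pow_dvd_two_mul] at hx
    by_cases hz : 2 ∣ z
    · obtain ⟨y, hy, h⟩ := ih z hx hz
      obtain ⟨z, rfl⟩ := hz
      have e (u v : Fin 6) : QLim (2 * (2 * z)) u v ↔ QLim (2 * z) (theta u) (theta v) := by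
        rw [QLim_two_mul, map_mul, map_ofNat, phi_two_mul, phi_two_mul]
      refine ⟨y, hy, ?_⟩
      rcases h with h | h
      · exact Or.inr fun u v => by rw [e, h]
      · exact Or.inl fun u v => by rw [e, h, theta_theta, theta_theta]
    · exact ⟨z, hz, Or.inl fun _ _ => Iff.rfl⟩

/-- The representative in `{-1, 0, 1, 2}³` of a residue. -/
def rep (r : R4) : Z3 := (r.1.valMinAbs, r.2.1.valMinAbs, r.2.2.valMinAbs)

lemma red_rep : ∀ r, red (rep r) = r := by decide +kernel

lemma valMinAbs_cases : ∀ a : ZMod 4, a.valMinAbs = -1 ∨ a.valMinAbs = 0 ∨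
    a.valMinAbs = 1 ∨ a.valMinAbs = 2 := by decide

lemma QLim_two_mul_congr {x y : Z3} (hx : ¬ 2 ∣ x) (h : red x = red y) (u v : Fin 6) :
    QLim (2 * x) u v ↔ QLim (2 * y) u v := by
  have hy : ¬ 2 ∣ y := by rwa [← ev_red_false, ← h, ev_red_false]
  rw [QLim_two_mul, QLim_two_mul, QLim_odd hx, QLim_odd hy, h]

section Local

variable {C3 : Set (Curve 3)} {P : ℕ → Set (Curve 3)}

lemma hat_conn_eq_seg {S T : Sym2 (Pt 3)} (h : (hatTrace P).conn S T) :
    ∃ x u v, u ≠ v ∧ S = seg x u ∧ T = seg x v ∧ TConn (hatTrace P) x u v := by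
  obtain ⟨n, h⟩ := h
  obtain ⟨x, u, v, huv, h1, h2, h3⟩ := traceOf_conn_eq_seg h
  exact ⟨x, u, v, huv, h1, h2, n, h3⟩

lemma Rx_eq (hC3 : traceOf C3 = CTrace) (hH : SatH C3 2 4) (hP : PowersOf C3 2 P) (x : Z3) :
    Rx P (emb x) = liftRel (QLim x) := by
  ext p q
  constructor
  · intro h
    obtain ⟨y, u, v, huv, h1, h2, h3⟩ := hat_conn_eq_seg h
    rw [seg, Sym2.eq_iff] at h1 h2
    have hx : x = y := by
      rcases h1 with ⟨h1, -⟩ | ⟨h1, -⟩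
      · exact emb_injective h1
      · rcases h2 with ⟨h2, -⟩ | ⟨h2, -⟩
        · exact emb_injective h2
        · have := emb_injective (h1.symm.trans h2)
          exact absurd (vec_injective (add_left_cancel this)) huv
    subst hx
    have key (p : Pt 3) (u : Fin 6) (h : (emb x = emb x ∧ emb x + p = emb (x + vec u)) ∨
        (emb x = emb (x + vec u) ∧ emb x + p = emb x)) : p = emb (vec u) := by
      rcases h with ⟨-, h⟩ | ⟨h, -⟩
      · rwa [emb_add, add_right_inj] at h
      · exact absurd (left_eq_add.1 (emb_injective h)) (vec_ne_zero u)
    exact ⟨u, v, (hat_conn hC3 hH hP x u v).1 h3, key p u h1, key q v h2⟩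
  · rintro ⟨u, v, h, rfl, rfl⟩
    exact (Rx_iff hC3 hH hP x u v).2 h

lemma satP_of (hC3 : traceOf C3 = CTrace) (hH : SatH C3 2 4) (hP : PowersOf C3 2 P)
    {y : Z3} (hy : ¬ 2 ∣ y) {K : Fin 6 → Fin 6 → Prop}
    (h : (∀ u v, K u v ↔ QLim (2 * y) u v) ∨
      ∀ u v, K u v ↔ QLim (2 * y) (theta u) (theta v)) : SatP P (liftRel K) := by
  have hr : red y = red (rep (red y)) := (red_rep _).symm
  have hrep : ¬ 2 ∣ rep (red y) := by rwa [← ev_red_false, ← hr, ev_red_false]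
  refine ⟨emb (2 * rep (red y)), fun i => ?_, fun h0 => hrep ?_, ?_⟩
  · rw [emb_two_mul]
    have (a : ZMod 4) : 2 * (a.valMinAbs : ℝ) = -2 ∨ 2 * (a.valMinAbs : ℝ) = 0 ∨
        2 * (a.valMinAbs : ℝ) = 2 ∨ 2 * (a.valMinAbs : ℝ) = 4 := by
      rcases valMinAbs_cases a with h | h | h | h <;> rw [h] <;> norm_num
    fin_cases i
    exacts [this _, this _, this _]
  · rw [emb_two_mul] at h0
    have (a : ZMod 4) (h : 2 * (a.valMinAbs : ℝ) = 0 ∨ 2 * (a.valMinAbs : ℝ) = 4) :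
        ∃ b, a.valMinAbs = 2 * b := by
      rcases valMinAbs_cases a with h' | h' | h' | h'
      · rw [h'] at h; norm_num at h
      · exact ⟨0, h'⟩
      · rw [h'] at h; norm_num at h
      · exact ⟨1, h'⟩
    obtain ⟨a, ha⟩ := this _ (h0 0)
    obtain ⟨b, hb⟩ := this _ (h0 1)
    obtain ⟨c, hc⟩ := this _ (h0 2)
    exact ⟨(a, b, c), Prod.ext ha (Prod.ext hb hc)⟩
  · rw [Rx_eq hC3 hH hP, Rtheta_liftRel]
    have e := QLim_two_mul_congr hy hr
    rcases h with h | h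
    · refine Or.inl ?_
      congr 1
      ext u v
      rw [h, e]
    · refine Or.inr ?_
      congr 1
      ext u v
      rw [h, e, theta_theta, theta_theta]

lemma hatR_conn_eq_seg {R : Pt 3 → Pt 3 → Prop} (hR : IsPairing R) {S T : Sym2 (Pt 3)}
    (h : (hatRTrace P R).conn S T) :
    ∃ x u v, u ≠ v ∧ S = seg x u ∧ T = seg x v ∧ TConn (hatRTrace P R) x u v := by
  have h' := h
  rcases h with h | ⟨p, q, hpq, rfl, rfl⟩
  · obtain ⟨x, u, v, huv, rfl, rfl, -⟩ := hat_conn_eq_seg h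
    exact ⟨x, u, v, huv, rfl, rfl, h'⟩
  · obtain ⟨hp, hq⟩ := hR.2.1 p q hpq
    obtain ⟨u, rfl⟩ := isDir_iff.1 hp
    obtain ⟨v, rfl⟩ := isDir_iff.1 hq
    have e (u : Fin 6) : s((0 : Pt 3), emb (vec u)) = seg 0 u := by rw [seg, zero_add, emb_zero]
    rw [e, e] at h' ⊢
    refine ⟨0, u, v, ?_, rfl, rfl, h'⟩
    rintro rfl
    exact hR.2.2.1 _ hpq

lemma hatR_conn_iff {R : Pt 3 → Pt 3 → Prop} (hR : IsPairing R) {x : Z3} {u v : Fin 6} :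
    TConn (hatRTrace P R) x u v ↔
      TConn (hatTrace P) x u v ∨ (x = 0 ∧ R (emb (vec u)) (emb (vec v))) := by
  have e (u : Fin 6) : s((0 : Pt 3), emb (vec u)) = seg 0 u := by rw [seg, zero_add, emb_zero]
  refine or_congr Iff.rfl ⟨?_, ?_⟩
  · rintro ⟨p, q, hpq, h1, h2⟩
    obtain ⟨hp, hq⟩ := hR.2.1 p q hpq
    obtain ⟨u', rfl⟩ := isDir_iff.1 hp
    obtain ⟨v', rfl⟩ := isDir_iff.1 hq
    rw [e] at h1 h2
    obtain ⟨h, rfl, rfl⟩ := seg_pair h1.symm h2.symm (by rintro rfl; exact hR.2.2.1 _ hpq)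
    exact ⟨h.symm, hpq⟩
  · rintro ⟨rfl, h⟩
    exact ⟨_, _, h, (e u).symm, (e v).symm⟩

lemma hatR_conn_ne (hC3 : traceOf C3 = CTrace) (hH : SatH C3 2 4) (hP : PowersOf C3 2 P)
    {R : Pt 3 → Pt 3 → Prop} (hR : IsPairing R) {x : Z3} (hx : x ≠ 0) (u v : Fin 6) :
    TConn (hatRTrace P R) x u v ↔ QLim x u v := by
  rw [hatR_conn_iff hR, hat_conn hC3 hH hP]
  simp [hx]

lemma hatR_conn_zero (hC3 : traceOf C3 = CTrace) (hH : SatH C3 2 4) (hP : PowersOf C3 2 P)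
    {R : Pt 3 → Pt 3 → Prop} (hR : IsPairing R) (u v : Fin 6) :
    TConn (hatRTrace P R) 0 u v ↔ R (emb (vec u)) (emb (vec v)) := by
  rw [hatR_conn_iff hR, hat_conn hC3 hH hP]
  simp [not_QLim_zero]

lemma exists_satP (hC3 : traceOf C3 = CTrace) (hH : SatH C3 2 4) (hP : PowersOf C3 2 P) :
    ∃ R, IsPairing R ∧ SatP P R :=
  ⟨_, isPairing_liftRel (x := 2 * (1, 0, 0)) (by decide),
    satP_of hC3 hH hP (y := (1, 0, 0)) (by rw [← ev_red_false]; decide)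
      (Or.inl fun _ _ => Iff.rfl)⟩

end Local

lemma mem_segPts_iff {x : Z3} {u : Fin 6} {p : Pt 3} :
    p ∈ segPts (seg x u) ↔ ∃ t : ℝ, 0 ≤ t ∧ t ≤ 1 ∧ p = emb x + t • emb (vec u) := by
  constructor
  · rintro ⟨a, b, h, t, h0, h1, rfl⟩
    rw [seg, Sym2.eq_iff] at h
    rcases h with ⟨rfl, rfl⟩ | ⟨rfl, rfl⟩
    · exact ⟨t, h0, h1, by rw [emb_add, add_sub_cancel_left]⟩
    · refine ⟨1 - t, by linarith, by linarith, ?_⟩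
      rw [emb_add]
      module
  · rintro ⟨t, h0, h1, rfl⟩
    exact ⟨_, _, rfl, t, h0, h1, by rw [emb_add, add_sub_cancel_left]⟩

/-- A real number which is an integer. -/
def IsInt (a : ℝ) : Prop := ∃ m : ℤ, a = m

/-- The union of the lattice segments. -/
def grid : Set (Pt 3) := {p | ∃ x u, p ∈ segPts (seg x u)}

lemma isInt_of_mem_grid {p : Pt 3} (hp : p ∈ grid) {i j : Fin 3} (hij : i ≠ j) :
    IsInt (p i) ∨ IsInt (p j) := by
  obtain ⟨x, u, hp⟩ := hp
  obtain ⟨t, -, -, rfl⟩ := mem_segPts_iff.1 hp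
  obtain ⟨k, h⟩ : ∃ k : Fin 3, ∀ i, i ≠ k → IsInt ((emb x + t • emb (vec u)) i) := by
    have hx (i : Fin 3) : IsInt (emb x i) := latt_iff.2 ⟨x, rfl⟩ i
    have key (i : Fin 3) (h : emb (vec u) i = 0) : IsInt ((emb x + t • emb (vec u)) i) := by
      rw [PiLp.add_apply, PiLp.smul_apply, h, smul_zero, add_zero]
      exact hx i
    obtain ⟨k, rfl | rfl⟩ := dir_cases u
    · refine ⟨k, fun i hi => key i ?_⟩
      rw [← uvec_eq]
      simp [uvec, hi]
    · refine ⟨k, fun i hi => key i ?_⟩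
      rw [← neg_uvec_eq]
      simp [uvec, hi]
  by_cases hi : i = k
  · exact Or.inr (h j fun hj => hij (hi.trans hj.symm))
  · exact Or.inl (h i hi)

lemma mem_grid_of_isInt {p : Pt 3} (k : Fin 3) (h : ∀ i, i ≠ k → IsInt (p i)) : p ∈ grid := by
  obtain ⟨x, hx⟩ : ∃ x, p - Int.fract (p k) • uvec 3 k = emb x := by
    refine latt_iff.1 fun i => ?_
    rw [PiLp.sub_apply, PiLp.smul_apply]
    by_cases hi : i = k
    · subst hi
      exact ⟨⌊p i⌋, by simp [uvec]⟩
    · obtain ⟨m, hm⟩ := h i hi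
      exact ⟨m, by simp [uvec, hi, hm]⟩
  refine ⟨x, Fin.castLE (by norm_num) k, mem_segPts_iff.2 ⟨Int.fract (p k),
    Int.fract_nonneg _, (Int.fract_lt_one _).le, ?_⟩⟩
  rw [← hx, ← uvec_eq, sub_add_cancel]

lemma mem_grid_add {p : Pt 3} (x : Z3) : p + emb x ∈ grid ↔ p ∈ grid := by
  have key (p : Pt 3) (x : Z3) (h : p ∈ grid) : p + emb x ∈ grid := by
    obtain ⟨y, u, h⟩ := h
    obtain ⟨t, h0, h1, rfl⟩ := mem_segPts_iff.1 h
    refine ⟨y + x, u, mem_segPts_iff.2 ⟨t, h0, h1, ?_⟩⟩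
    rw [emb_add, add_right_comm]
  refine ⟨fun h => ?_, key p x⟩
  have := key _ (-x) h
  rwa [emb_neg, add_neg_cancel_right] at this

lemma latt_of_shift {y : Pt 3} {r : ℝ} (hr : 2 ≤ r)
    (h : ∀ p ∈ grid, p ∈ Metric.closedBall y r → p - y ∈ grid) : latt y := by
  have key (k : Fin 3) : ∀ i, i ≠ k → IsInt (y i) := by
    let p : Pt 3 := toPt3 fun i => if i = k then y i + 1 / 2 else round (y i)
    have hpk : p k = y k + 1 / 2 := if_pos rfl
    have hpi (i : Fin 3) (hi : i ≠ k) : p i = round (y i) := if_neg hi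
    have hc (i : Fin 3) : |(p - y) i| ≤ 1 / 2 := by
      rw [PiLp.sub_apply]
      by_cases hi : i = k
      · subst hi
        rw [hpk, add_sub_cancel_left]
        norm_num [abs_of_pos]
      · rw [hpi i hi, abs_sub_comm]
        exact abs_sub_round (y i)
    have hball : p ∈ Metric.closedBall y r := by
      rw [mem_closedBall_iff_norm, EuclideanSpace.norm_eq]
      refine le_trans (Real.sqrt_le_left (y := 2) (by norm_num) |>.2 ?_) hr
      have (i : Fin 3) : ‖(p - y) i‖ ^ 2 ≤ 1 := by
        rw [Real.norm_eq_abs]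
        have h1 := hc i
        have h2 := abs_nonneg ((p - y) i)
        nlinarith
      rw [Fin.sum_univ_three]
      linarith [this 0, this 1, this 2]
    have hgrid : p ∈ grid := mem_grid_of_isInt k fun i hi => ⟨_, hpi i hi⟩
    have hsub := h p hgrid hball
    intro i hi
    rcases isInt_of_mem_grid hsub hi with ⟨m, hm⟩ | ⟨m, hm⟩
    · rw [PiLp.sub_apply, hpi i hi] at hm
      exact ⟨round (y i) - m, by push_cast; linarith⟩
    · rw [PiLp.sub_apply, hpk, add_sub_cancel_left] at hm
      exfalso
      have : (1 : ℝ) = ((2 * m : ℤ) : ℝ) := by push_cast; linarith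
      have : (1 : ℤ) = 2 * m := by exact_mod_cast this
      omega
  intro i
  by_cases hi : i = 0
  · exact key 1 i (by rw [hi]; decide)
  · exact key 0 i hi

lemma norm_emb_vec (u : Fin 6) : ‖emb (vec u)‖ = 1 := by
  obtain ⟨k, rfl | rfl⟩ := dir_cases u
  · rw [← uvec_eq]
    simp [uvec]
  · rw [← neg_uvec_eq]
    simp [uvec]

lemma segPts_subset_closedBall (x z : Z3) (u : Fin 6) {r : ℝ} (h : ‖emb z‖ + 1 ≤ r) :
    segPts (seg (x + z) u) ⊆ Metric.closedBall (emb x) r := by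
  intro p hp
  obtain ⟨t, h0, h1, rfl⟩ := mem_segPts_iff.1 hp
  rw [mem_closedBall_iff_norm, emb_add, add_assoc, add_sub_cancel_left]
  refine (norm_add_le _ _).trans (le_trans ?_ h)
  rw [norm_smul, norm_emb_vec, mul_one, Real.norm_of_nonneg h0]
  linarith

lemma pts_eq_grid {T : Trace 3} (hT : T.segs = {S | IsSeg S}) : T.pts = grid := by
  ext p
  simp only [Trace.pts, hT, mem_iUnion, exists_prop, grid, mem_ofPred_eq]
  constructor
  · rintro ⟨S, hS, hp⟩
    obtain ⟨x, u, rfl⟩ := isSeg_iff.1 hS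
    exact ⟨x, u, hp⟩
  · rintro ⟨x, u, hp⟩
    exact ⟨_, isSeg_iff.2 ⟨x, u, rfl⟩, hp⟩

lemma pts_traceOf_subset (E : Set (Curve 3)) : (traceOf E).pts ⊆ grid := by
  intro p hp
  obtain ⟨S, hS, hp⟩ := mem_iUnion₂.1 hp
  obtain ⟨x, u, rfl⟩ := isSeg_iff.1 (traceOf_segs_isSeg hS)
  exact ⟨x, u, hp⟩

lemma exists_positive (x : Z3) (u : Fin 6) : ∃ y k, seg x u = seg y (Fin.castLE (by norm_num) k) ∧
    emb x + (1 / 2 : ℝ) • emb (vec u) = emb y + (1 / 2 : ℝ) • uvec 3 k := by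
  obtain ⟨k, rfl | rfl⟩ := dir_cases u
  · exact ⟨x, k, rfl, by rw [uvec_eq]⟩
  · refine ⟨x + vec (neg (Fin.castLE (by norm_num) k)), k, ?_, ?_⟩
    · rw [← seg_neg, neg_neg]
    · rw [emb_add, ← neg_uvec_eq]
      module

lemma seg_eq_of_midpoint {x x' : Z3} {u u' : Fin 6}
    (h : emb x + (1 / 2 : ℝ) • emb (vec u) ∈ segPts (seg x' u')) : seg x u = seg x' u' := by
  obtain ⟨y, k, hy, hk⟩ := exists_positive x u
  obtain ⟨y', l, hy', -⟩ := exists_positive x' u'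
  rw [hk, hy'] at h
  rw [hy, hy']
  obtain ⟨t, h0, h1, ht⟩ := mem_segPts_iff.1 h
  rw [← uvec_eq] at ht
  have hc (i : Fin 3) : emb y i + (1 / 2 : ℝ) * uvec 3 k i = emb y' i + t * uvec 3 l i := by
    simpa using congrArg (fun p : Pt 3 => p i) ht
  have hkk : uvec 3 k k = 1 := by simp [uvec]
  have huv {i j : Fin 3} (hij : i ≠ j) : uvec 3 j i = 0 := by simp [uvec, hij]
  have hi (z : Z3) (i : Fin 3) : IsInt (emb z i) := latt_iff.2 ⟨z, rfl⟩ i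
  obtain ⟨a, ha⟩ := hi y k
  obtain ⟨b, hb⟩ := hi y' k
  have hck := hc k
  rw [ha, hb, hkk] at hck
  have hkl : k = l := by
    by_contra hkl
    rw [huv hkl] at hck
    have : (2 * a + 1 : ℤ) = 2 * b := by
      have : ((2 * a + 1 : ℤ) : ℝ) = ((2 * b : ℤ) : ℝ) := by push_cast; linarith
      exact_mod_cast this
    omega
  subst hkl
  rw [hkk] at hck
  have hab : a = b := by
    have h2 : (2 * a : ℤ) ≤ 2 * b + 1 := by
      have : ((2 * a : ℤ) : ℝ) ≤ ((2 * b + 1 : ℤ) : ℝ) := by push_cast; linarith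
      exact_mod_cast this
    have h3 : (2 * b : ℤ) ≤ 2 * a + 1 := by
      have : ((2 * b : ℤ) : ℝ) ≤ ((2 * a + 1 : ℤ) : ℝ) := by push_cast; linarith
      exact_mod_cast this
    omega
  have : y = y' := by
    apply emb_injective
    ext i
    by_cases hik : i = k
    · rw [hik, ha, hb, hab]
    · simpa [huv hik] using hc i
  rw [this]

lemma exists_shift {E : Set (Curve 3)} {T : Trace 3} (hT : T.segs = {S | IsSeg S})
    (h : LocallyIso (traceOf E) T) (x : Z3) (r : ℝ) :
    ∃ y, (∀ u, seg x u ∈ (traceOf E).segs) ∧ ∀ z u v, ‖emb z‖ + 1 ≤ r →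
      (TConn (traceOf E) (x + z) u v ↔ TConn T (y + z) u v) := by
  obtain ⟨q, hpts, hconn, hconn'⟩ := h.1 (emb x) (max r 2) (by positivity)
  rw [pts_eq_grid hT] at hpts
  have hq : latt q := by
    refine latt_of_shift (le_max_right r 2) fun p hp hp' => ?_
    obtain ⟨p', ⟨hpE, -⟩, rfl⟩ : p ∈ (fun p => p + (q - emb x)) ''
      ((traceOf E).pts ∩ Metric.closedBall (emb x) (max r 2)) := hpts ▸ ⟨hp, hp'⟩
    have := pts_traceOf_subset E hpE
    rw [show p' + (q - emb x) - q = p' + emb (-x) by rw [emb_neg]; abel]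
    exact (mem_grid_add _).2 this
  obtain ⟨y, rfl⟩ := latt_iff.1 hq
  refine ⟨y, fun u => ?_, fun z u v hz => ⟨fun hc => ?_, fun hc => ?_⟩⟩
  · set p := emb y + (1 / 2 : ℝ) • emb (vec u) with hp
    have hpg : p ∈ segPts (seg y u) := mem_segPts_iff.2 ⟨1 / 2, by norm_num, by norm_num, rfl⟩
    have hpb : p ∈ Metric.closedBall (emb y) (max r 2) := by
      refine segPts_subset_closedBall y 0 u ?_ (by rwa [add_zero])
      rw [emb_zero, norm_zero]
      exact le_max_of_le_right (by norm_num)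
    obtain ⟨p', ⟨hp', -⟩, he⟩ : p ∈ (fun p => p + (emb y - emb x)) ''
      ((traceOf E).pts ∩ Metric.closedBall (emb x) (max r 2)) := hpts ▸ ⟨⟨y, u, hpg⟩, hpb⟩
    have he : p' = emb x + (1 / 2 : ℝ) • emb (vec u) := by
      rw [hp, ← eq_sub_iff_add_eq] at he
      rw [he]
      abel
    obtain ⟨S, hS, hp'⟩ := mem_iUnion₂.1 hp'
    obtain ⟨x', u', rfl⟩ := isSeg_iff.1 (traceOf_segs_isSeg hS)
    rw [he] at hp'
    rwa [seg_eq_of_midpoint hp']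
  · have hz' : ‖emb z‖ + 1 ≤ max r 2 := le_max_of_le_left hz
    have := hconn _ _ hc (segPts_subset_closedBall x z u hz')
      (segPts_subset_closedBall x z v hz')
    rw [← emb_sub, map_seg, map_seg, show x + z + (y - x) = y + z by ring] at this
    exact this
  · have hz' : ‖emb z‖ + 1 ≤ max r 2 := le_max_of_le_left hz
    have := hconn' _ _ hc (segPts_subset_closedBall y z u hz')
      (segPts_subset_closedBall y z v hz')
    rw [← emb_sub, map_seg, map_seg, show y + z + (x - y) = x + z by ring] at this
    exact this

lemma segs_eq_of_locallyIso {E : Set (Curve 3)} {T : Trace 3} (hT : T.segs = {S | IsSeg S})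
    (h : LocallyIso (traceOf E) T) : (traceOf E).segs = {S | IsSeg S} := by
  ext S
  refine ⟨traceOf_segs_isSeg, fun hS => ?_⟩
  obtain ⟨x, u, rfl⟩ := isSeg_iff.1 hS
  obtain ⟨y, hy, -⟩ := exists_shift hT h x 0
  exact hy u

/-- The sets of curves with the connexions of translates of `Ĉ` in large regions. -/
lemma exists_lev {C3 : Set (Curve 3)} {P : ℕ → Set (Curve 3)} (hC3 : traceOf C3 = CTrace)
    (hH : SatH C3 2 4) (hP : PowersOf C3 2 P) {R : Pt 3 → Pt 3 → Prop} (hR : IsPairing R)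
    {E : Set (Curve 3)} (h : LocallyIso (traceOf E) (hatRTrace P R)) (n : ℕ) :
    ∃ t, Lev n (TConn (traceOf E)) t := by
  have hT : (hatRTrace P R).segs = {S | IsSeg S} := hat_segs hC3 hH hP
  choose y hy using fun N : ℕ => (exists_shift hT h 0 N).imp fun _ h => h.2
  let M := 2 ^ (n + 1)
  have : NeZero M := ⟨by positivity⟩
  obtain ⟨c, hc⟩ := Finite.exists_infinite_fiber
    fun N => (((y N).1 : ZMod M), ((y N).2.1 : ZMod M), ((y N).2.2 : ZMod M))
  rw [Set.infinite_coe_iff] at hc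
  obtain ⟨N₀, hN₀⟩ := hc.nonempty
  refine ⟨y N₀, fun x hx u v => ?_⟩
  obtain ⟨k, hk⟩ := exists_nat_ge (‖emb x‖ + 1)
  obtain ⟨N, hN, hkN⟩ := hc.exists_gt k
  have hdvd : 2 ^ (n + 1) ∣ y N - y N₀ := by
    have e := (show _ = c from hN₀).trans (show _ = c from hN).symm
    simp only [Prod.mk.injEq, ZMod.intCast_eq_intCast_iff_dvd_sub, M] at e
    push_cast at e
    obtain ⟨⟨a, ha⟩, ⟨b, hb⟩, ⟨d, hd⟩⟩ := e
    exact ⟨(a, b, d), Prod.ext ha (Prod.ext hb hd)⟩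
  have hne : ¬ 2 ^ n ∣ y N + x := by
    intro hd
    apply hx
    have := dvd_sub hd ((pow_dvd_pow 2 n.le_succ).trans hdvd)
    rwa [show y N + x - (y N - y N₀) = x + y N₀ by ring] at this
  have hloc := hy N x u v (hk.trans (by exact_mod_cast hkN.le))
  rw [zero_add] at hloc
  rw [hloc, hatR_conn_ne hC3 hH hP hR (by rintro h0; exact hne (h0 ▸ dvd_zero _)), QLim_iff hne]
  refine (Q_congr ?_ u v).symm
  rwa [show y N + x - (x + y N₀) = y N - y N₀ by ring]

/-- An unbounded curve contains a one-sided infinite path. -/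
lemma Curve.exists_path {A : Curve 3} (hA : ¬ A.dom.Finite) : ∃ (w : ℕ → Z3) (s : ℕ → Fin 6),
    (∀ i, w (i + 1) = w i + vec (s i)) ∧
    ∀ i, A.conn (seg (w (i + 1)) (neg (s i))) (seg (w (i + 1)) (s (i + 1))) := by
  wlog hb : ¬ BddAbove A.dom generalizing A
  · have hb' : ¬ BddBelow A.dom := fun h => hA (h.finite_of_bddAbove (not_not.1 hb))
    have hr : ¬ BddAbove A.reverse.dom := by
      rintro ⟨m, hm⟩
      refine hb' ⟨-m, fun i hi => ?_⟩
      have := hm (A.mem_reverse_dom.2 (by rwa [_root_.neg_neg]) : -i ∈ A.reverse.dom)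
      omega
    obtain ⟨w, s, hw, hc⟩ := this (fun h => hr h.bddAbove) hr
    exact ⟨w, s, hw, fun i => A.conn_of_reverse (hc i)⟩
  obtain ⟨m, hm, -⟩ := A.nontriv
  have hdom (i : ℕ) : m + i ∈ A.dom := by
    obtain ⟨k, hk, hik⟩ := not_bddAbove_iff.1 hb (m + i)
    exact A.ordConn.out hm hk ⟨by omega, hik.le⟩
  choose w hw using fun i => latt_iff.1 (A.lattice _ (hdom i))
  have hnext (i : ℕ) : ∃ u, w (i + 1) = w i + vec u := by
    obtain ⟨u, hu⟩ := A.exists_next (hdom i)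
      (by have := hdom (i + 1); push_cast at this; rwa [← add_assoc] at this) (hw i)
    refine ⟨u, emb_injective ?_⟩
    rw [← hw, ← hu]
    push_cast
    rw [add_assoc]
  choose s hs using hnext
  refine ⟨w, s, hs, fun i => ⟨m + (i + 1 : ℕ), ?_, ?_, Or.inl ⟨?_, ?_⟩⟩⟩
  · convert hdom i using 1
    push_cast
    ring
  · convert hdom (i + 2) using 1
    push_cast
    ring
  · rw [show m + (i + 1 : ℕ) - 1 = m + (i : ℤ) by push_cast; ring, hw, hw, hs, seg_neg, seg]
  · rw [show m + (i + 1 : ℕ) + 1 = m + ((i + 2 : ℕ) : ℤ) by push_cast; ring, hw, hw, hs (i + 1),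
      seg]

lemma isPath_of_subCurve {A : Curve 3} {E : Set (Curve 3)} (h : ∃ c ∈ E, SubCurve A c)
    {w : ℕ → Z3} {s : ℕ → Fin 6} (hw : ∀ i, w (i + 1) = w i + vec (s i))
    (hc : ∀ i, A.conn (seg (w (i + 1)) (neg (s i))) (seg (w (i + 1)) (s (i + 1)))) :
    IsPath (TConn (traceOf E)) w s := by
  obtain ⟨c, hcE, -, hsub⟩ := h
  exact ⟨hw, fun i => ⟨c, hcE, hsub _ _ (hc i)⟩⟩

lemma TConn_transl {E : Set (Curve 3)} (x z : Z3) (u v : Fin 6) :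
    TConn (Trace.transl (-emb x) (traceOf E)) z u v ↔ TConn (traceOf E) (z + x) u v := by
  rw [← emb_neg]
  constructor
  · rintro ⟨S, T, hST, hS, hT⟩
    obtain ⟨y, a, b, hab, rfl, rfl, h⟩ := traceOf_conn_eq_seg hST
    rw [map_seg] at hS hT
    obtain ⟨hy, rfl, rfl⟩ := seg_pair hS.symm hT.symm hab
    rwa [← hy, neg_add_cancel_right]
  · intro h
    refine ⟨_, _, h, ?_, ?_⟩ <;> rw [map_seg, add_neg_cancel_right]

lemma transl_eq_hatR {C3 : Set (Curve 3)} {P : ℕ → Set (Curve 3)} (hC3 : traceOf C3 = CTrace)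
    (hH : SatH C3 2 4) (hP : PowersOf C3 2 P) {R : Pt 3 → Pt 3 → Prop} (hR : IsPairing R)
    {E : Set (Curve 3)} (hE : (traceOf E).segs = {S | IsSeg S}) {x : Z3}
    (h0 : ∀ u v, TConn (traceOf E) x u v ↔ R (emb (vec u)) (emb (vec v)))
    (h : ∀ z, z ≠ 0 → ∀ u v, TConn (traceOf E) (x + z) u v ↔ QLim z u v) :
    Trace.transl (-emb x) (traceOf E) = hatRTrace P R := by
  have key (z : Z3) (u v : Fin 6) : TConn (Trace.transl (-emb x) (traceOf E)) z u v ↔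
      TConn (hatRTrace P R) z u v := by
    rw [TConn_transl]
    by_cases hz : z = 0
    · rw [hz, zero_add, h0, hatR_conn_zero hC3 hH hP hR]
    · rw [add_comm, h z hz, hatR_conn_ne hC3 hH hP hR hz]
  have hsegs : (Trace.transl (-emb x) (traceOf E)).segs = (hatRTrace P R).segs := by
    refine Eq.trans ?_ (hat_segs hC3 hH hP).symm
    ext S
    constructor
    · rintro ⟨T, hT, rfl⟩
      obtain ⟨y, u, rfl⟩ := isSeg_iff.1 (hE ▸ hT)
      rw [← emb_neg, map_seg]
      exact isSeg_iff.2 ⟨_, _, rfl⟩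
    · intro hS
      obtain ⟨y, u, rfl⟩ := isSeg_iff.1 hS
      refine ⟨seg (y + x) u, hE ▸ isSeg_iff.2 ⟨_, _, rfl⟩, ?_⟩
      rw [← emb_neg, map_seg, add_neg_cancel_right]
  have hconn : (Trace.transl (-emb x) (traceOf E)).conn = (hatRTrace P R).conn := by
    ext S T
    constructor
    · intro hST
      obtain ⟨A, B, hAB, rfl, rfl⟩ := hST
      obtain ⟨y, a, b, -, rfl, rfl, h⟩ := traceOf_conn_eq_seg hAB
      rw [← emb_neg, map_seg, map_seg]
      refine (key _ _ _).1 ((TConn_transl _ _ _ _).2 ?_)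
      rwa [neg_add_cancel_right]
    · intro hST
      obtain ⟨y, a, b, -, rfl, rfl, h⟩ := hatR_conn_eq_seg hR hST
      exact (key _ _ _).2 h
  cases hT : Trace.transl (-emb x) (traceOf E)
  rw [hT] at hsegs hconn
  cases hsegs
  cases hconn
  rfl

lemma traceOf_eq {E F : Set (Curve 3)} (hs : (traceOf E).segs = (traceOf F).segs)
    (h : ∀ x u v, TConn (traceOf E) x u v ↔ TConn (traceOf F) x u v) :
    traceOf E = traceOf F := by
  have hc : (traceOf E).conn = (traceOf F).conn := by
    ext S T
    rw [traceOf_conn_iff, traceOf_conn_iff]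
    simp only [h]
  cases hT : traceOf E
  rw [hT] at hs hc
  cases hs
  cases hc
  rfl

lemma conn_iff_of_ne {E F : Set (Curve 3)} {x : Z3}
    (h : ∀ z, z ≠ x → ∀ u v, TConn (traceOf E) z u v ↔ TConn (traceOf F) z u v)
    {S T : Sym2 (Pt 3)} (hST : ¬ (emb x ∈ S ∧ emb x ∈ T)) :
    (traceOf E).conn S T ↔ (traceOf F).conn S T := by
  rw [traceOf_conn_iff, traceOf_conn_iff]
  have hne {z : Z3} {u v : Fin 6} (hS : S = seg z u) (hT : T = seg z v) : z ≠ x := by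
    rintro rfl
    exact hST ⟨hS ▸ Sym2.mem_mk_left _ _, hT ▸ Sym2.mem_mk_left _ _⟩
  constructor <;> rintro ⟨z, u, v, hS, hT, hc⟩
  · exact ⟨z, u, v, hS, hT, (h z (hne hS hT) u v).1 hc⟩
  · exact ⟨z, u, v, hS, hT, (h z (hne hS hT) u v).2 hc⟩

lemma Lev.iff_of_dvd {n : ℕ} {K K' : Z3 → Fin 6 → Fin 6 → Prop} {t t' : Z3} (h : Lev n K t)
    (h' : Lev n K' t') (hd : 2 ^ (n + 1) ∣ t - t') {x : Z3} (hx : ¬ 2 ^ n ∣ x + t) (u v : Fin 6) :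
    K x u v ↔ K' x u v := by
  have hx' : ¬ 2 ^ n ∣ x + t' := by
    intro hx'
    have := dvd_add hx' ((pow_dvd_pow 2 n.le_succ).trans hd)
    rw [show x + t' + (t - t') = x + t by ring] at this
    exact hx this
  rw [h x hx, h' x hx']
  refine (Q_congr ?_ u v).symm
  rwa [show x + t - (x + t') = t - t' by ring]

/-- A set of curves which looks like `Ĉ` around one of its points is a covering `Ĉ_S`. -/
lemma exists_hatR {C3 : Set (Curve 3)} {P : ℕ → Set (Curve 3)} (hC3 : traceOf C3 = CTrace)
    (hH : SatH C3 2 4) (hP : PowersOf C3 2 P) {R : Pt 3 → Pt 3 → Prop} (hR : IsPairing R)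
    (hRP : SatP P R) {E : Set (Curve 3)} (hE : LocallyIso (traceOf E) (hatRTrace P R)) {x : Z3}
    (h : ∀ z, z ≠ 0 → ∀ u v, TConn (traceOf E) (x + z) u v ↔ QLim z u v) :
    ∃ S, IsPairing S ∧ SatP P S ∧ Trace.transl (-emb x) (traceOf E) = hatRTrace P S := by
  have hT : (hatRTrace P R).segs = {S | IsSeg S} := hat_segs hC3 hH hP
  have hs := segs_eq_of_locallyIso hT hE
  obtain ⟨r, hr⟩ := (Set.finite_range fun a => ‖emb (rep a)‖ + 1).bddAbove
  obtain ⟨y, -, hy⟩ := exists_shift hT hE x (max r 1)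
  have hy0 (u v : Fin 6) : TConn (traceOf E) x u v ↔ TConn (hatRTrace P R) y u v := by
    simpa using hy 0 u v (by rw [emb_zero, norm_zero, zero_add]; exact le_max_right _ _)
  by_cases h0 : y = 0
  · refine ⟨R, hR, hRP, transl_eq_hatR hC3 hH hP hR hs (fun u v => ?_) h⟩
    rw [hy0, h0, hatR_conn_zero hC3 hH hP hR]
  have heven : 2 ∣ y := by
    by_contra hodd
    obtain ⟨a, ha, hya, u, hu⟩ := exists_pr_ne (red y) ((ev_red_false y).2 hodd)
    have hz : ¬ 2 ∣ rep a := by rwa [← ev_red_false, red_rep]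
    have hyz : ¬ 2 ∣ y + rep a := by rwa [← ev_red_false, map_add, red_rep]
    have ne_zero {z : Z3} (hz : ¬ 2 ∣ z) : z ≠ 0 := by
      rintro rfl
      exact hz (dvd_zero _)
    have e := hy (rep a) u (pr a u) ((hr ⟨a, rfl⟩).trans (le_max_left _ _))
    rw [h _ (ne_zero hz), hatR_conn_ne hC3 hH hP hR (ne_zero hyz), QLim_odd hz, QLim_odd hyz,
      map_add, red_rep] at e
    exact hu (e.1 rfl).symm
  obtain ⟨n, hn⟩ := exists_not_two_pow_dvd h0
  obtain ⟨y', hy', hK⟩ := QLim_even n y hn heven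
  have hS := isPairing_liftRel h0
  refine ⟨_, hS, satP_of hC3 hH hP hy' hK,
    transl_eq_hatR hC3 hH hP hS hs (fun u v => ?_) h⟩
  rw [hy0, hatR_conn_ne hC3 hH hP hR h0, liftRel_emb]

/-- Proposition 2.12: let `ℰ, ℱ` be sets of curves locally isomorphic
to the coverings `Ĉ_R` for `R` satisfying (P), and `A` an unbounded curve contained in
a curve of `ℰ` and in a curve of `ℱ`.  If `(ℰ, x) ≅ (Ĉ_S, 0)` for some `x ∈ ℤ³` and
some pairing relation `S` satisfying (P), then `ℰ` and `ℱ` can only differ by the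
connexions between their segments having `x` as an endpoint; otherwise `ℰ = ℱ`. -/
theorem statement19 (C3 : Set (Curve 3)) (hC3 : traceOf C3 = CTrace)
    (hH : SatH C3 2 4) (P : ℕ → Set (Curve 3)) (hP : PowersOf C3 2 P)
    (E F : Set (Curve 3))
    (hEloc : ∀ R : Pt 3 → Pt 3 → Prop, IsPairing R → SatP P R →
      LocallyIso (traceOf E) (hatRTrace P R))
    (hFloc : ∀ R : Pt 3 → Pt 3 → Prop, IsPairing R → SatP P R →
      LocallyIso (traceOf F) (hatRTrace P R))
    (A : Curve 3) (hAunb : ¬ A.dom.Finite)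
    (hAE : ∃ c ∈ E, SubCurve A c) (hAF : ∃ c ∈ F, SubCurve A c) :
    (∀ x : Pt 3, latt x → ∀ S : Pt 3 → Pt 3 → Prop, IsPairing S → SatP P S →
      Trace.transl (-x) (traceOf E) = hatRTrace P S →
      ((traceOf E).segs = (traceOf F).segs ∧
        ∀ S1 S2 : Sym2 (Pt 3), ¬ (x ∈ S1 ∧ x ∈ S2) →
          ((traceOf E).conn S1 S2 ↔ (traceOf F).conn S1 S2))) ∧
    ((¬ ∃ x : Pt 3, latt x ∧ ∃ S : Pt 3 → Pt 3 → Prop, IsPairing S ∧ SatP P S ∧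
        Trace.transl (-x) (traceOf E) = hatRTrace P S) →
      traceOf E = traceOf F) := by
  obtain ⟨R, hR, hRP⟩ := exists_satP hC3 hH hP
  have hsegs : (hatRTrace P R).segs = {S | IsSeg S} := hat_segs hC3 hH hP
  have hE := hEloc R hR hRP
  have hF := hFloc R hR hRP
  have hseg : (traceOf E).segs = (traceOf F).segs :=
    (segs_eq_of_locallyIso hsegs hE).trans (segs_eq_of_locallyIso hsegs hF).symm
  obtain ⟨w, s, hw, hc⟩ := A.exists_path hAunb
  have hpE := isPath_of_subCurve hAE hw hc
  have hpF := isPath_of_subCurve hAF hw hc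
  choose tE htE using exists_lev hC3 hH hP hR hE
  choose tF htF using exists_lev hC3 hH hP hR hF
  constructor
  · intro p hp S hS _ heq
    obtain ⟨x, rfl⟩ := latt_iff.1 hp
    refine ⟨hseg, fun S1 S2 => conn_iff_of_ne fun z hz u v => ?_⟩
    have hlev (n : ℕ) : Lev n (TConn (traceOf E)) (-x) := by
      intro y hy u v
      have hne : y + -x ≠ 0 := by
        intro h0
        exact hy (h0 ▸ dvd_zero _)
      rw [← QLim_iff hy, ← hatR_conn_ne hC3 hH hP hS hne, ← heq, TConn_transl,
        neg_add_cancel_right]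
    obtain ⟨n, hn⟩ := exists_not_two_pow_dvd (add_neg_eq_zero.not.2 hz)
    exact (hlev (n + 1)).iff_of_dvd (htF (n + 1)) (hpE.dvd n hpF (hlev _) (htF _))
      (fun hd => hn ((pow_dvd_pow 2 n.le_succ).trans hd)) u v
  · intro hno
    refine traceOf_eq hseg fun x u v => ?_
    by_cases hx : ∃ n, ¬ 2 ^ n ∣ x + tE n
    · obtain ⟨_ | n, hn⟩ := hx
      · simp at hn
      · exact (htE _).iff_of_dvd (htF _) (hpE.dvd n hpF (htE _) (htF _)) hn u v
    · push Not at hx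
      refine absurd ?_ hno
      refine ⟨emb x, latt_iff.2 ⟨x, rfl⟩, exists_hatR hC3 hH hP hR hRP hE fun z hz u v => ?_⟩
      obtain ⟨n, hn⟩ := exists_not_two_pow_dvd hz
      have e : x + z + tE (n + 1) - (x + tE (n + 1)) = z := by ring
      have hd {k : ℕ} (hk : k ≤ n + 1) (h : 2 ^ k ∣ x + z + tE (n + 1)) : 2 ^ k ∣ z :=
        e ▸ dvd_sub h ((pow_dvd_pow 2 hk).trans (hx (n + 1)))
      rw [htE (n + 1) (x + z) fun h => hn ((pow_dvd_pow 2 n.le_succ).trans (hd le_rfl h)),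
        Q_succ n _ fun h => hn (hd n.le_succ h), QLim_iff hn]
      refine (Q_congr ?_ u v).symm
      rw [show x + z + tE (n + 1) - z = x + tE (n + 1) by ring]
      exact hx (n + 1)

end
end Folding
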